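/- Assume β ∈ (ϖ2, 0) in Case [N2] (in particular θ < −2 and f_ρ(β) > 0). Then for every b > 0 and c > 0 there exists a unique positive solution u_{b,∞,c} of equation (E) in ℝ^N∖{0} satisfying u(x)/(b Φ_{ϖ2}(|x|)) → 1 as |x| → 0 and u(x) → c as |x| → ∞. Moreover u_{b,∞,c} is radially symmetric with radial derivative positive on (0,∞). -/

import Mathlib

open MeasureTheory Filter Topology Real RealInnerProductSpace

noncomputable section

/-- The gradient factor `G_τ(x,z,ξ) = z^τ ‖ξ‖^(1-τ) / ‖x‖^(τ+1)`.
For `τ = 0` this equals `‖ξ‖ / ‖x‖`, since `z ^ (0:ℝ) = 1` for real powers. -/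
def Gt {N : ℕ} (τ : ℝ) (x : EuclideanSpace ℝ (Fin N)) (z : ℝ)
    (ξ : EuclideanSpace ℝ (Fin N)) : ℝ :=
  z ^ τ * ‖ξ‖ ^ (1 - τ) / ‖x‖ ^ (τ + 1)

/-- Test functions: `C¹` functions with compact support contained in `Ω \ {0}`. -/
def IsTestFun {N : ℕ} (Ω : Set (EuclideanSpace ℝ (Fin N)))
    (φ : EuclideanSpace ℝ (Fin N) → ℝ) : Prop :=
  ContDiff ℝ 1 φ ∧ HasCompactSupport φ ∧ tsupport φ ⊆ Ω \ {0}

/-- The distributional pairing of equation (E) with a test function `φ`: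
`∫ ∇u·∇φ + (N-2+2ρ) ∫ ((x·∇u)/|x|²) φ - λ ∫ G_τ(x,u,∇u) φ + ∫ |x|^θ u^q φ`. -/
def weakE (N : ℕ) (ρ lam τ θ q : ℝ) (Ω : Set (EuclideanSpace ℝ (Fin N)))
    (u φ : EuclideanSpace ℝ (Fin N) → ℝ) : ℝ :=
  (∫ x in Ω \ {0}, ⟪gradient u x, gradient φ x⟫)
    + ((N : ℝ) - 2 + 2 * ρ) * (∫ x in Ω \ {0}, ⟪x, gradient u x⟫ / ‖x‖ ^ 2 * φ x)
    - lam * (∫ x in Ω \ {0}, Gt τ x (u x) (gradient u x) * φ x)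
    + ∫ x in Ω \ {0}, ‖x‖ ^ θ * u x ^ q * φ x

/-- A positive `C¹` function on `Ω \ {0}`. -/
def PosC1 {N : ℕ} (Ω : Set (EuclideanSpace ℝ (Fin N)))
    (u : EuclideanSpace ℝ (Fin N) → ℝ) : Prop :=
  ContDiffOn ℝ 1 u (Ω \ {0}) ∧ ∀ x ∈ Ω \ {0}, 0 < u x

/-- Positive distributional solution of equation (E) in `Ω \ {0}`. -/
def IsSolutionE (N : ℕ) (ρ lam τ θ q : ℝ) (Ω : Set (EuclideanSpace ℝ (Fin N)))
    (u : EuclideanSpace ℝ (Fin N) → ℝ) : Prop :=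
  PosC1 Ω u ∧ ∀ φ, IsTestFun Ω φ → weakE N ρ lam τ θ q Ω u φ = 0

/-- Positive sub-solution of equation (E) in `Ω \ {0}`. -/
def IsSubSolutionE (N : ℕ) (ρ lam τ θ q : ℝ) (Ω : Set (EuclideanSpace ℝ (Fin N)))
    (u : EuclideanSpace ℝ (Fin N) → ℝ) : Prop :=
  PosC1 Ω u ∧ ∀ φ, IsTestFun Ω φ → (∀ x, 0 ≤ φ x) → weakE N ρ lam τ θ q Ω u φ ≤ 0

/-- Positive super-solution of equation (E) in `Ω \ {0}`. -/
def IsSuperSolutionE (N : ℕ) (ρ lam τ θ q : ℝ) (Ω : Set (EuclideanSpace ℝ (Fin N)))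
    (u : EuclideanSpace ℝ (Fin N) → ℝ) : Prop :=
  PosC1 Ω u ∧ ∀ φ, IsTestFun Ω φ → (∀ x, 0 ≤ φ x) → 0 ≤ weakE N ρ lam τ θ q Ω u φ

/-- `f_ρ(t) = t (t + 2ρ) + λ |t|^(1-τ)`. -/
def fRho (ρ lam τ t : ℝ) : ℝ := t * (t + 2 * ρ) + lam * |t| ^ (1 - τ)

/-- `Υ = ((τ+1)/(2τ)) (λτ)^(1/(τ+1))`. -/
def Upsilon (lam τ : ℝ) : ℝ := ((τ + 1) / (2 * τ)) * (lam * τ) ^ (1 / (τ + 1))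

/-- Case [N₀]: (a) `τ = 0` and `λ ≥ 2ρ`, or (b) `λ > 0`, `τ ∈ (0,1)` and `ρ < Υ`. -/
def CaseN0 (ρ lam τ : ℝ) : Prop :=
  (τ = 0 ∧ 2 * ρ ≤ lam) ∨ (0 < lam ∧ 0 < τ ∧ τ < 1 ∧ ρ < Upsilon lam τ)

/-- Case [N₁]: (a) `τ = 0` and `λ < 2ρ`, or (b) `λ < 0` and `τ ∈ (0,1)`. -/
def CaseN1 (ρ lam τ : ℝ) : Prop :=
  (τ = 0 ∧ lam < 2 * ρ) ∨ (lam < 0 ∧ 0 < τ ∧ τ < 1)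

/-- Case [N₂]: `λ > 0`, `τ ∈ (0,1)` and `ρ ≥ Υ`. -/
def CaseN2 (ρ lam τ : ℝ) : Prop :=
  0 < lam ∧ 0 < τ ∧ τ < 1 ∧ Upsilon lam τ ≤ ρ

/-- `w` is the smallest negative root of `f_ρ` (i.e. `w = ϖ₁`). -/
def IsMinNegRoot (ρ lam τ w : ℝ) : Prop :=
  w < 0 ∧ fRho ρ lam τ w = 0 ∧ ∀ t, t < 0 → fRho ρ lam τ t = 0 → w ≤ t

/-- `w` is the largest negative root of `f_ρ` (i.e. `w = ϖ₂`). -/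
def IsMaxNegRoot (ρ lam τ w : ℝ) : Prop :=
  w < 0 ∧ fRho ρ lam τ w = 0 ∧ ∀ t, t < 0 → fRho ρ lam τ t = 0 → t ≤ w

/-- `Φ_{ϖ₂}(r)`: equal to `r^(-ϖ₂)` if `ρ > Υ` and to `r^(-ϖ₂) |log r|^(2/(1+τ))` if `ρ = Υ`. -/
def Phi2 (ρ lam τ w2 r : ℝ) : ℝ :=
  if ρ = Upsilon lam τ then r ^ (-w2) * |Real.log r| ^ (2 / (1 + τ)) else r ^ (-w2)

/-- `Ψ_{ϖ₁}(t)`: equal to `t^(-ϖ₁)` if `ρ > Υ` and to `t^(-ϖ₁) (log t)^(2/(1+τ))` if `ρ = Υ`. -/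
def Psi1 (ρ lam τ w1 t : ℝ) : ℝ :=
  if ρ = Upsilon lam τ then t ^ (-w1) * (Real.log t) ^ (2 / (1 + τ)) else t ^ (-w1)

/-- The radial operator `L_{ρ,λ,τ}[P](r) = P'' + (1-2ρ) P'/r + λ P^τ |P'|^(1-τ)/r^(1+τ)`. -/
def Lrad (ρ lam τ : ℝ) (P : ℝ → ℝ) (r : ℝ) : ℝ :=
  deriv (deriv P) r + (1 - 2 * ρ) * deriv P r / r
    + lam * P r ^ τ * |deriv P r| ^ (1 - τ) / r ^ (1 + τ)

/-- The Laplacian of `u` at `x`, as the trace of the second derivative. -/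
def lapl {N : ℕ} (u : EuclideanSpace ℝ (Fin N) → ℝ) (x : EuclideanSpace ℝ (Fin N)) : ℝ :=
  ∑ i : Fin N, iteratedFDeriv ℝ 2 u x ![EuclideanSpace.single i 1, EuclideanSpace.single i 1]

/-- `∫ Dψ(x)(x - x₀) dx = -N ∫ ψ` for compactly supported `C¹` functions. -/
theorem integral_fderiv_apply_sub {N : ℕ} {ψ : EuclideanSpace ℝ (Fin N) → ℝ}
    (hψ : ContDiff ℝ 1 ψ) (hc : HasCompactSupport ψ) (x₀ : EuclideanSpace ℝ (Fin N)) :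
    ∫ x, fderiv ℝ ψ x (x - x₀) = -(N : ℝ) * ∫ x, ψ x := by
  have hcont : Continuous (fderiv ℝ ψ) := hψ.continuous_fderiv one_ne_zero
  have hcs : HasCompactSupport (fderiv ℝ ψ) := hc.fderiv (𝕜 := ℝ)
  have hd : Differentiable ℝ ψ := hψ.differentiable one_ne_zero
  have key : ∀ i : Fin N, ∫ x, (x i - x₀ i) * fderiv ℝ ψ x (EuclideanSpace.single i 1)
      = - ∫ x, ψ x := by
    intro i
    have hL : ∀ x : EuclideanSpace ℝ (Fin N),
        HasFDerivAt (fun x : EuclideanSpace ℝ (Fin N) => x i - x₀ i)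
          (EuclideanSpace.proj i : EuclideanSpace ℝ (Fin N) →L[ℝ] ℝ) x := fun x =>
      (EuclideanSpace.proj (𝕜 := ℝ) i).hasFDerivAt.sub_const _
    have hLc : Continuous (fun x : EuclideanSpace ℝ (Fin N) => x i - x₀ i) := by fun_prop
    have h1 : ∀ x : EuclideanSpace ℝ (Fin N),
        fderiv ℝ (fun x : EuclideanSpace ℝ (Fin N) => x i - x₀ i) x
          (EuclideanSpace.single i 1) = 1 := by
      intro x; rw [(hL x).fderiv]; simp
    rw [integral_mul_fderiv_eq_neg_fderiv_mul_of_integrable]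
    · simp only [h1, one_mul]
    · simp only [h1, one_mul]
      exact hψ.continuous.integrable_of_hasCompactSupport hc
    · refine Continuous.integrable_of_hasCompactSupport (hLc.mul (by fun_prop)) ?_
      refine HasCompactSupport.mul_left ?_
      exact hcs.comp_left (g := fun T : EuclideanSpace ℝ (Fin N) →L[ℝ] ℝ =>
        T (EuclideanSpace.single i 1)) (by simp)
    · exact (hLc.mul hψ.continuous).integrable_of_hasCompactSupport hc.mul_left
    · exact fun x _ => (hL x).differentiableAt
    · exact fun x _ => hd x
  have hsum : ∀ x : EuclideanSpace ℝ (Fin N), fderiv ℝ ψ x (x - x₀)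
      = ∑ i, (x i - x₀ i) * fderiv ℝ ψ x (EuclideanSpace.single i 1) := by
    intro x
    conv_lhs => rw [← (EuclideanSpace.basisFun (Fin N) ℝ).sum_repr (x - x₀)]
    simp [map_sum]
  simp_rw [hsum]
  rw [integral_finsetSum]
  · simp [key]
  · intro i _
    refine Continuous.integrable_of_hasCompactSupport (by fun_prop) ?_
    refine HasCompactSupport.mul_left ?_
    exact hcs.comp_left (g := fun T : EuclideanSpace ℝ (Fin N) →L[ℝ] ℝ =>
        T (EuclideanSpace.single i 1)) (by simp)

/-- A function continuous on an open set, multiplied by a continuous function supported in it,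
is continuous. -/
theorem continuous_mul_of_tsupport_subset {E : Type*} [TopologicalSpace E] {U : Set E}
    (hU : IsOpen U) {f φ : E → ℝ} (hf : ContinuousOn f U) (hφ : Continuous φ)
    (hs : tsupport φ ⊆ U) : Continuous fun x => f x * φ x := by
  rw [continuous_iff_continuousAt]
  intro x
  by_cases hx : x ∈ U
  · exact (hf.continuousAt (hU.mem_nhds hx)).mul hφ.continuousAt
  · have hx' : x ∉ tsupport φ := fun h => hx (hs h)
    have : (fun x => f x * φ x) =ᶠ[𝓝 x] fun _ => 0 := by
      filter_upwards [notMem_tsupport_iff_eventuallyEq.mp hx'] with y hy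
      simp [hy]
    exact this.continuousAt

/-- The zeroth-order part of the weak form of (E). -/
def lowerTerm {N : ℕ} (ρ lam τ θ q : ℝ) (u : EuclideanSpace ℝ (Fin N) → ℝ)
    (x : EuclideanSpace ℝ (Fin N)) : ℝ :=
  ((N : ℝ) - 2 + 2 * ρ) * (⟪x, gradient u x⟫ / ‖x‖ ^ 2) - lam * Gt τ x (u x) (gradient u x)
    + ‖x‖ ^ θ * u x ^ q

theorem continuousOn_gradient {N : ℕ} {u : EuclideanSpace ℝ (Fin N) → ℝ}
    {U : Set (EuclideanSpace ℝ (Fin N))} (hU : IsOpen U) (hu : ContDiffOn ℝ 1 u U) :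
    ContinuousOn (gradient u) U :=
  (InnerProductSpace.toDual ℝ _).symm.continuous.comp_continuousOn
    (hu.continuousOn_fderiv_of_isOpen hU le_rfl)

theorem inner_gradient_eq {N : ℕ} (u : EuclideanSpace ℝ (Fin N) → ℝ)
    (x y : EuclideanSpace ℝ (Fin N)) : ⟪gradient u x, y⟫ = fderiv ℝ u x y := by
  simp [gradient]

theorem isTestFun_tsupport_gradient {N : ℕ} (φ : EuclideanSpace ℝ (Fin N) → ℝ) :
    tsupport (gradient φ) ⊆ tsupport φ := by
  refine subset_trans ?_ (tsupport_fderiv_subset ℝ (f := φ))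
  refine closure_mono ?_
  intro x hx hx'
  exact hx (by simp [gradient, hx'])

section weak
variable {N : ℕ} {ρ lam τ θ q : ℝ} {u φ : EuclideanSpace ℝ (Fin N) → ℝ}

theorem continuousOn_lowerTerm (hτ1 : τ < 1) (hu : PosC1 Set.univ u) :
    ContinuousOn (lowerTerm ρ lam τ θ q u) (Set.univ \ {0}) ∧
    ContinuousOn (fun x => ⟪x, gradient u x⟫ / ‖x‖ ^ 2) (Set.univ \ {0}) ∧
    ContinuousOn (fun x => Gt τ x (u x) (gradient u x)) (Set.univ \ {0}) ∧
    ContinuousOn (fun x => ‖x‖ ^ θ * u x ^ q) (Set.univ \ {0}) := by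
  have hU : IsOpen ((Set.univ : Set (EuclideanSpace ℝ (Fin N))) \ {0}) :=
    isOpen_univ.sdiff isClosed_singleton
  have hg := continuousOn_gradient hU hu.1
  have huc := hu.1.continuousOn
  have hn : ContinuousOn (fun x : EuclideanSpace ℝ (Fin N) => ‖x‖) (Set.univ \ {0}) :=
    continuous_norm.continuousOn
  have h0 : ∀ x ∈ (Set.univ : Set (EuclideanSpace ℝ (Fin N))) \ {0}, ‖x‖ ≠ 0 := by
    intro x hx; simpa using hx.2
  have h1 : ContinuousOn (fun x => ⟪x, gradient u x⟫ / ‖x‖ ^ 2) (Set.univ \ {0}) :=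
    (continuousOn_id.inner hg).div (hn.pow 2) (fun x hx => pow_ne_zero _ (h0 x hx))
  have h2 : ContinuousOn (fun x => Gt τ x (u x) (gradient u x)) (Set.univ \ {0}) := by
    unfold Gt
    refine ((huc.rpow_const fun x hx => Or.inl (hu.2 x hx).ne').mul
      (hg.norm.rpow_const fun x hx => Or.inr (by linarith))).div
      (hn.rpow_const fun x hx => Or.inl (h0 x hx)) ?_
    intro x hx
    exact (rpow_pos_of_pos (lt_of_le_of_ne (norm_nonneg _) (h0 x hx).symm) _).ne'
  have h3 : ContinuousOn (fun x => ‖x‖ ^ θ * u x ^ q) (Set.univ \ {0}) :=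
    (hn.rpow_const fun x hx => Or.inl (h0 x hx)).mul
      (huc.rpow_const fun x hx => Or.inl (hu.2 x hx).ne')
  exact ⟨((continuousOn_const.mul h1).sub (continuousOn_const.mul h2)).add h3, h1, h2, h3⟩

theorem integrable_inner_gradient (hu : ContDiffOn ℝ 1 u (Set.univ \ {0}))
    (hφ : IsTestFun Set.univ φ) : Integrable fun x => ⟪gradient u x, gradient φ x⟫ := by
  have hU : IsOpen ((Set.univ : Set (EuclideanSpace ℝ (Fin N))) \ {0}) :=
    isOpen_univ.sdiff isClosed_singleton
  have hg := continuousOn_gradient hU hu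
  have hgφ : Continuous (gradient φ) :=
    (InnerProductSpace.toDual ℝ _).symm.continuous.comp (hφ.1.continuous_fderiv one_ne_zero)
  have hz : ∀ x ∉ tsupport φ, gradient φ x = 0 := fun x hx =>
    image_eq_zero_of_notMem_tsupport fun h => hx (isTestFun_tsupport_gradient φ h)
  refine Continuous.integrable_of_hasCompactSupport ?_ ?_
  · rw [continuous_iff_continuousAt]
    intro x
    by_cases hx : x ∈ (Set.univ : Set (EuclideanSpace ℝ (Fin N))) \ {0}
    · exact (hg.continuousAt (hU.mem_nhds hx)).inner hgφ.continuousAt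
    · have hx' : x ∉ tsupport φ := fun h => hx (hφ.2.2 h)
      have : (fun x => ⟪gradient u x, gradient φ x⟫) =ᶠ[𝓝 x] fun _ => 0 := by
        filter_upwards [(isClosed_tsupport φ).isOpen_compl.mem_nhds hx'] with y hy
        simp [hz y hy]
      exact this.continuousAt
  · refine HasCompactSupport.intro hφ.2.1 ?_
    intro x hx
    simp [hz x hx]

theorem integrable_mul_testFun {f : EuclideanSpace ℝ (Fin N) → ℝ}
    (hf : ContinuousOn f (Set.univ \ {0})) (hφ : IsTestFun Set.univ φ) :
    Integrable fun x => f x * φ x :=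
  (continuous_mul_of_tsupport_subset (isOpen_univ.sdiff isClosed_singleton) hf
    hφ.1.continuous hφ.2.2).integrable_of_hasCompactSupport hφ.2.1.mul_left

theorem weakE_eq (hN : 2 ≤ N) (hτ1 : τ < 1) (hu : PosC1 Set.univ u)
    (hφ : IsTestFun Set.univ φ) :
    weakE N ρ lam τ θ q Set.univ u φ
      = (∫ x, ⟪gradient u x, gradient φ x⟫) + ∫ x, lowerTerm ρ lam τ θ q u x * φ x := by
  obtain ⟨-, h1, h2, h3⟩ := continuousOn_lowerTerm (ρ := ρ) (lam := lam) (θ := θ) (q := q) hτ1 hu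
  have hne : Nonempty (Fin N) := ⟨⟨0, by omega⟩⟩
  have hr : (volume : Measure (EuclideanSpace ℝ (Fin N))).restrict (Set.univ \ {0}) = volume := by
    rw [← Set.compl_eq_univ_sdiff]
    exact Measure.restrict_eq_self_of_ae_mem (by
      rw [ae_iff]; simp)
  unfold weakE
  rw [hr]
  have i1 := integrable_mul_testFun h1 hφ
  have i2 := integrable_mul_testFun h2 hφ
  have i3 := integrable_mul_testFun h3 hφ
  have : ∫ x, lowerTerm ρ lam τ θ q u x * φ x
      = ∫ x, (((N : ℝ) - 2 + 2 * ρ) * (⟪x, gradient u x⟫ / ‖x‖ ^ 2 * φ x)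
        - lam * (Gt τ x (u x) (gradient u x) * φ x)) + ‖x‖ ^ θ * u x ^ q * φ x := by
    congr 1; ext x; unfold lowerTerm; ring
  have i12 : Integrable fun x => ((N : ℝ) - 2 + 2 * ρ) * (⟪x, gradient u x⟫ / ‖x‖ ^ 2 * φ x)
      - lam * (Gt τ x (u x) (gradient u x) * φ x) := (i1.const_mul _).sub (i2.const_mul _)
  rw [this, integral_add i12 i3,
    integral_sub (i1.const_mul _) (i2.const_mul _), integral_const_mul, integral_const_mul]
  ring

end weak

theorem hasDerivAt_max_zero_sq (x : ℝ) :
    HasDerivAt (fun x : ℝ => max x 0 ^ 2) (2 * max x 0) x := by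
  rcases lt_trichotomy x 0 with h | h | h
  · have : (fun x : ℝ => max x 0 ^ 2) =ᶠ[𝓝 x] fun _ => 0 := by
      filter_upwards [Iio_mem_nhds h] with y hy
      simp [max_eq_right (le_of_lt (Set.mem_Iio.mp hy))]
    rw [max_eq_right h.le, mul_zero]
    exact (hasDerivAt_const x (0 : ℝ)).congr_of_eventuallyEq this
  · subst h
    rw [hasDerivAt_iff_isLittleO_nhds_zero]
    simp only [zero_add, max_self, mul_zero, smul_eq_mul, ne_eq, OfNat.ofNat_ne_zero,
      not_false_eq_true, zero_pow, sub_zero]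
    refine Asymptotics.IsBigO.trans_isLittleO (g := fun h : ℝ => h ^ 2) ?_ ?_
    · refine Asymptotics.IsBigO.of_bound 1 (Eventually.of_forall fun y => ?_)
      rw [norm_of_nonneg (by positivity), norm_of_nonneg (by positivity), one_mul]
      rcases le_total y 0 with hy | hy
      · rw [max_eq_right hy]; simpa using sq_nonneg y
      · rw [max_eq_left hy]
    · exact Asymptotics.isLittleO_pow_id one_lt_two
  · have : (fun x : ℝ => max x 0 ^ 2) =ᶠ[𝓝 x] fun x => x ^ 2 := by
      filter_upwards [Ioi_mem_nhds h] with y hy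
      simp [max_eq_left (le_of_lt (Set.mem_Ioi.mp hy))]
    rw [max_eq_left h.le]
    have h2 := (hasDerivAt_pow 2 x).congr_of_eventuallyEq this
    simpa using h2

theorem contDiff_max_zero_sq : ContDiff ℝ 1 fun x : ℝ => max x 0 ^ 2 := by
  rw [contDiff_one_iff_deriv]
  refine ⟨fun x => (hasDerivAt_max_zero_sq x).differentiableAt, ?_⟩
  have : deriv (fun x : ℝ => max x 0 ^ 2) = fun x => 2 * max x 0 :=
    funext fun x => (hasDerivAt_max_zero_sq x).deriv
  rw [this]; fun_prop

section Comparison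

variable {N : ℕ}

/-- A `C¹` function which is weakly strictly superharmonic near `x₀`, in the sense that its weak
Laplacian is a continuous function negative at `x₀`, has no minimum at `x₀`. -/
theorem not_min_of_weak_laplacian_neg (hN : 2 ≤ N) {D H : EuclideanSpace ℝ (Fin N) → ℝ}
    (hD : ContDiffOn ℝ 1 D (Set.univ \ {0})) (hH : ContinuousOn H (Set.univ \ {0}))
    (hw : ∀ φ, IsTestFun Set.univ φ →
      (∫ x, ⟪gradient D x, gradient φ x⟫) = - ∫ x, H x * φ x)
    {x₀ : EuclideanSpace ℝ (Fin N)} (hx₀ : x₀ ≠ 0) (hneg : H x₀ < 0) (hD0 : D x₀ = 0)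
    (hmin : ∀ x, x ≠ 0 → 0 ≤ D x) : False := by
  have hU : IsOpen ((Set.univ : Set (EuclideanSpace ℝ (Fin N))) \ {0}) :=
    isOpen_univ.sdiff isClosed_singleton
  have hxU : x₀ ∈ (Set.univ : Set (EuclideanSpace ℝ (Fin N))) \ {0} := ⟨trivial, hx₀⟩
  have hNpos : (0 : ℝ) < N := by exact_mod_cast (by omega : 0 < N)
  set δ := -H x₀ / 2 with hδ
  have hδpos : 0 < δ := by rw [hδ]; linarith
  have hev : ∀ᶠ x in 𝓝 x₀, H x < -δ ∧ x ∈ (Set.univ : Set (EuclideanSpace ℝ (Fin N))) \ {0} :=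
    ((hH.continuousAt (hU.mem_nhds hxU)).eventually (Iio_mem_nhds (by rw [hδ]; linarith))).and
      (hU.mem_nhds hxU)
  obtain ⟨r, hr, hball⟩ := Metric.eventually_nhds_iff_ball.mp hev
  set η := δ / (4 * N) with hη
  have hηpos : 0 < η := by positivity
  set μ := η * (r / 2) ^ 2 with hμ
  have hμpos : 0 < μ := by positivity
  let E : EuclideanSpace ℝ (Fin N) → ℝ := fun x => D x + η * ‖x - x₀‖ ^ 2
  let φ : EuclideanSpace ℝ (Fin N) → ℝ :=
    (Metric.ball x₀ r).indicator fun x => max (μ - E x) 0 ^ 2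
  have hEgrad : ∀ x ∈ Metric.ball x₀ r, HasFDerivAt E
      (fderiv ℝ D x + (2 * η) • innerSL ℝ (x - x₀)) x := by
    intro x hx
    have h1 : HasFDerivAt D (fderiv ℝ D x) x :=
      ((hD.differentiableOn one_ne_zero).differentiableAt
        (hU.mem_nhds (hball x hx).2)).hasFDerivAt
    have h2 : HasFDerivAt (fun x => ‖x - x₀‖ ^ 2) (2 • innerSL ℝ (x - x₀)) x := by
      have := ((hasFDerivAt_id x).sub_const x₀).norm_sq
      simpa using this
    refine (h1.add (h2.const_mul η)).congr_fderiv ?_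
    ext v; simp; ring
  have hEC : ContDiffOn ℝ 1 E (Metric.ball x₀ r) := by
    refine (hD.mono fun x hx => (hball x hx).2).add ?_
    exact (contDiff_const.mul ((contDiff_id.sub contDiff_const).norm_sq ℝ)).contDiffOn
  have hzero : ∀ x, x ∉ Metric.closedBall x₀ (r / 2) → φ x = 0 := by
    intro x hx
    simp only [φ, Set.indicator]
    split_ifs with h
    · have h1 := hmin x (hball x h).2.2
      have h2 : r / 2 < ‖x - x₀‖ := by
        rw [← dist_eq_norm]; simpa using hx
      have : μ ≤ E x := by
        simp only [E, hμ]
        have := mul_le_mul_of_nonneg_left (pow_le_pow_left₀ (by positivity) h2.le 2) hηpos.le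
        linarith
      rw [max_eq_right (by linarith)]; norm_num
    · rfl
  have hts : tsupport φ ⊆ Metric.closedBall x₀ (r / 2) := by
    refine closure_minimal ?_ Metric.isClosed_closedBall
    intro x hx; by_contra h; exact hx (hzero x h)
  have hsub : Metric.closedBall x₀ (r / 2) ⊆ Metric.ball x₀ r :=
    Metric.closedBall_subset_ball (by linarith)
  have heq : ∀ x ∈ Metric.ball x₀ r, φ =ᶠ[𝓝 x] fun x => max (μ - E x) 0 ^ 2 := by
    intro x hx
    filter_upwards [Metric.isOpen_ball.mem_nhds hx] with y hy
    simp [φ, hy]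
  have hφC : ContDiff ℝ 1 φ := by
    rw [contDiff_iff_contDiffAt]
    intro x
    by_cases hx : x ∈ Metric.ball x₀ r
    · refine ContDiffAt.congr_of_eventuallyEq ?_ (heq x hx)
      exact contDiff_max_zero_sq.contDiffAt.comp x
        (contDiffAt_const.sub (hEC.contDiffAt (Metric.isOpen_ball.mem_nhds hx)))
    · have hx' : x ∉ tsupport φ := fun h => hx (hsub (hts h))
      exact contDiffAt_const.congr_of_eventuallyEq (notMem_tsupport_iff_eventuallyEq.mp hx')
  have hφT : IsTestFun Set.univ φ := by
    refine ⟨hφC, ?_, fun x hx => (hball x (hsub (hts hx))).2⟩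
    exact HasCompactSupport.of_support_subset_isCompact (isCompact_closedBall x₀ (r / 2))
      (subset_closure.trans hts)
  have hφ0 : ∀ x, 0 ≤ φ x := fun x => Set.indicator_nonneg (fun _ _ => by positivity) x
  have hφd : ∀ x ∈ Metric.ball x₀ r, HasFDerivAt φ
      (-(2 * max (μ - E x) 0) • (fderiv ℝ D x + (2 * η) • innerSL ℝ (x - x₀))) x := by
    intro x hx
    refine HasFDerivAt.congr_of_eventuallyEq ?_ (heq x hx)
    refine ((hasDerivAt_max_zero_sq (μ - E x)).comp_hasFDerivAt x
      ((hEgrad x hx).const_sub μ)).congr_fderiv ?_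
    ext v; simp; ring
  have hpt : ∀ x, ⟪gradient D x, gradient φ x⟫ + 2 * η * fderiv ℝ φ x (x - x₀) ≤ 0 := by
    intro x
    by_cases hx : x ∈ Metric.ball x₀ r
    · have h1 : ⟪gradient D x, gradient φ x⟫ = fderiv ℝ φ x (gradient D x) := by
        rw [real_inner_comm, inner_gradient_eq]
      have h2 : fderiv ℝ D x + (2 * η) • innerSL ℝ (x - x₀)
          = innerSL ℝ (gradient D x + (2 * η) • (x - x₀)) := by
        ext v
        simp
      have h3 : fderiv ℝ φ x (gradient D x) + 2 * η * fderiv ℝ φ x (x - x₀)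
          = fderiv ℝ φ x (gradient D x + (2 * η) • (x - x₀)) := by simp
      rw [h1, h3, (hφd x hx).fderiv, h2]
      have : 0 ≤ ⟪gradient D x + (2 * η) • (x - x₀), gradient D x + (2 * η) • (x - x₀)⟫ :=
        real_inner_self_nonneg
      have h5 : (0 : ℝ) ≤ max (μ - E x) 0 := le_max_right _ _
      have := mul_nonneg h5 this
      simp only [smul_apply, innerSL_apply_apply, smul_eq_mul]
      linarith
    · have hx' : x ∉ tsupport φ := fun h => hx (hsub (hts h))
      have : fderiv ℝ φ x = 0 := image_eq_zero_of_notMem_tsupport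
        fun h => hx' (tsupport_fderiv_subset ℝ h)
      simp [gradient, this]
  have hInt1 := integrable_inner_gradient hD hφT
  have hdc : Continuous fun x => fderiv ℝ φ x (x - x₀) :=
    (hφC.continuous_fderiv one_ne_zero).clm_apply (by fun_prop)
  have hInt2 : Integrable fun x => fderiv ℝ φ x (x - x₀) := by
    refine hdc.integrable_of_hasCompactSupport (HasCompactSupport.intro hφT.2.1 ?_)
    intro x hx
    have : fderiv ℝ φ x = 0 := image_eq_zero_of_notMem_tsupport
        fun h => hx (tsupport_fderiv_subset ℝ h)
    simp [this]
  have hle : (∫ x, ⟪gradient D x, gradient φ x⟫) + 2 * η * ∫ x, fderiv ℝ φ x (x - x₀) ≤ 0 := by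
    rw [← integral_const_mul, ← integral_add hInt1 (hInt2.const_mul _)]
    exact integral_nonpos hpt
  rw [hw φ hφT, integral_fderiv_apply_sub hφC hφT.2.1] at hle
  have hφi : Integrable φ := hφC.continuous.integrable_of_hasCompactSupport hφT.2.1
  have hHi := integrable_mul_testFun hH hφT
  have h6 : ∫ x, H x * φ x ≤ ∫ x, -δ * φ x := by
    refine integral_mono hHi (hφi.const_mul _) fun x => ?_
    by_cases hx : x ∈ Metric.ball x₀ r
    · exact mul_le_mul_of_nonneg_right (hball x hx).1.le (hφ0 x)
    · simp [φ, hx]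
  rw [integral_const_mul] at h6
  have hpos : 0 < ∫ x, φ x := by
    refine hφC.continuous.integral_pos_of_hasCompactSupport_nonneg_nonzero hφT.2.1 hφ0 (x := x₀) ?_
    have : φ x₀ = μ ^ 2 := by
      simp [φ, hr, E, hD0, max_eq_left hμpos.le]
    rw [this]; positivity
  have h7 : 2 * η * (-(N : ℝ) * ∫ x, φ x) = -(δ / 2) * ∫ x, φ x := by
    rw [hη]; field_simp; ring
  rw [h7] at hle
  nlinarith

theorem gradient_const_mul_sub {u₁ u₂ : EuclideanSpace ℝ (Fin N) → ℝ}
    {x : EuclideanSpace ℝ (Fin N)} (M : ℝ) (h₁ : DifferentiableAt ℝ u₁ x)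
    (h₂ : DifferentiableAt ℝ u₂ x) :
    gradient (fun x => M * u₂ x - u₁ x) x = M • gradient u₂ x - gradient u₁ x := by
  have : fderiv ℝ (fun x => M * u₂ x - u₁ x) x = M • fderiv ℝ u₂ x - fderiv ℝ u₁ x :=
    ((h₂.hasFDerivAt.const_mul M).sub h₁.hasFDerivAt).fderiv
  simp [gradient, this]

/-- Comparison principle: solutions whose quotient tends to `1` at the origin and at infinity
are ordered. -/
theorem solution_le_of_tendsto_div {ρ lam τ θ q : ℝ} (hN : 2 ≤ N) (hτ1 : τ < 1) (hq : 1 < q)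
    {u₁ u₂ : EuclideanSpace ℝ (Fin N) → ℝ}
    (h₁ : IsSolutionE N ρ lam τ θ q Set.univ u₁) (h₂ : IsSolutionE N ρ lam τ θ q Set.univ u₂)
    (hz : Tendsto (fun x => u₁ x / u₂ x) (𝓝[≠] 0) (𝓝 1))
    (hi : Tendsto (fun x => u₁ x / u₂ x) (cocompact _) (𝓝 1))
    {x : EuclideanSpace ℝ (Fin N)} (hx : x ≠ 0) : u₁ x ≤ u₂ x := by
  by_contra! hlt
  have hU : IsOpen ((Set.univ : Set (EuclideanSpace ℝ (Fin N))) \ {0}) :=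
    isOpen_univ.sdiff isClosed_singleton
  have hp₂ : ∀ y, y ≠ 0 → 0 < u₂ y := fun y hy => h₂.1.2 y ⟨trivial, hy⟩
  have hp₁ : ∀ y, y ≠ 0 → 0 < u₁ y := fun y hy => h₁.1.2 y ⟨trivial, hy⟩
  set R := fun x => u₁ x / u₂ x with hR
  have hRx : 1 < R x := by rw [hR]; exact (one_lt_div (hp₂ x hx)).mpr hlt
  have hRc : ContinuousOn R (Set.univ \ {0}) :=
    h₁.1.1.continuousOn.div h₂.1.1.continuousOn fun y hy => (hp₂ y hy.2).ne'
  obtain ⟨x₀, hx₀, hmax⟩ : ∃ x₀, x₀ ≠ 0 ∧ ∀ y, y ≠ 0 → R y ≤ R x₀ := by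
    have e1 := hz.eventually (Iio_mem_nhds hRx)
    have e2 := hi.eventually (Iio_mem_nhds hRx)
    rw [eventually_nhdsWithin_iff, Metric.eventually_nhds_iff_ball] at e1
    obtain ⟨ε, hε, he1⟩ := e1
    obtain ⟨K, hK, he2⟩ := mem_cocompact.mp e2
    have hKc : IsCompact (K ∩ (Metric.ball (0 : EuclideanSpace ℝ (Fin N)) ε)ᶜ) :=
      hK.inter_right Metric.isOpen_ball.isClosed_compl
    have hsubU : K ∩ (Metric.ball (0 : EuclideanSpace ℝ (Fin N)) ε)ᶜ ⊆ Set.univ \ {0} := by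
      rintro y ⟨-, hy⟩
      refine ⟨trivial, ?_⟩
      rintro rfl
      exact hy (Metric.mem_ball_self hε)
    have hout : ∀ y, y ≠ 0 → y ∉ K ∩ (Metric.ball (0 : EuclideanSpace ℝ (Fin N)) ε)ᶜ →
        R y < R x := by
      intro y hy hy'
      by_cases hb : y ∈ Metric.ball (0 : EuclideanSpace ℝ (Fin N)) ε
      · exact he1 y hb hy
      · exact he2 fun hyK => hy' ⟨hyK, hb⟩
    have hxK : x ∈ K ∩ (Metric.ball (0 : EuclideanSpace ℝ (Fin N)) ε)ᶜ := by
      by_contra h; exact lt_irrefl _ (hout x hx h)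
    obtain ⟨x₀, hx₀, hm⟩ := hKc.exists_isMaxOn ⟨x, hxK⟩ (hRc.mono hsubU)
    refine ⟨x₀, (hsubU hx₀).2, fun y hy => ?_⟩
    by_cases hyK : y ∈ K ∩ (Metric.ball (0 : EuclideanSpace ℝ (Fin N)) ε)ᶜ
    · exact hm hyK
    · exact (hout y hy hyK).le.trans (hm hxK)
  set M := R x₀ with hM
  have hM1 : 1 < M := hRx.trans_le (hmax x hx)
  have hM0 : 0 < M := by linarith
  have hMx : M * u₂ x₀ = u₁ x₀ := by
    rw [hM, hR]; exact div_mul_cancel₀ _ (hp₂ x₀ hx₀).ne'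
  have hd : ∀ u : EuclideanSpace ℝ (Fin N) → ℝ, PosC1 Set.univ u → ∀ y, y ≠ 0 →
      DifferentiableAt ℝ u y := fun u hu y hy =>
    (hu.1.differentiableOn one_ne_zero).differentiableAt (hU.mem_nhds ⟨trivial, hy⟩)
  have hgr : ∀ y, y ≠ 0 → gradient (fun x => M * u₂ x - u₁ x) y
      = M • gradient u₂ y - gradient u₁ y := fun y hy =>
    gradient_const_mul_sub M (hd u₁ h₁.1 y hy) (hd u₂ h₂.1 y hy)
  have hmin : ∀ y, y ≠ 0 → 0 ≤ M * u₂ y - u₁ y := by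
    intro y hy
    have := hmax y hy
    rw [hR] at this
    have := (div_le_iff₀ (hp₂ y hy)).mp this
    linarith
  have hgx : gradient u₁ x₀ = M • gradient u₂ x₀ := by
    have hloc : IsLocalMin (fun x => M * u₂ x - u₁ x) x₀ := by
      filter_upwards [hU.mem_nhds ⟨trivial, hx₀⟩] with y hy
      have := hmin y hy.2
      simpa [hMx] using this
    have h0 := hgr x₀ hx₀
    rw [gradient, hloc.fderiv_eq_zero, map_zero] at h0
    exact (sub_eq_zero.mp h0.symm).symm
  refine not_min_of_weak_laplacian_neg hN (D := fun x => M * u₂ x - u₁ x)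
    (H := fun x => M * lowerTerm ρ lam τ θ q u₂ x - lowerTerm ρ lam τ θ q u₁ x)
    ((contDiffOn_const.mul h₂.1.1).sub h₁.1.1)
    ((continuousOn_const.mul (continuousOn_lowerTerm hτ1 h₂.1).1).sub
      (continuousOn_lowerTerm hτ1 h₁.1).1) ?_ hx₀ ?_ (by simp [hMx]) hmin
  · intro φ hφ
    have w₁ := h₁.2 φ hφ
    have w₂ := h₂.2 φ hφ
    rw [weakE_eq hN hτ1 h₁.1 hφ] at w₁
    rw [weakE_eq hN hτ1 h₂.1 hφ] at w₂
    have i₁ := integrable_inner_gradient h₁.1.1 hφ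
    have i₂ := integrable_inner_gradient h₂.1.1 hφ
    have j₁ := integrable_mul_testFun (continuousOn_lowerTerm (ρ := ρ) (lam := lam) (θ := θ)
      (q := q) hτ1 h₁.1).1 hφ
    have j₂ := integrable_mul_testFun (continuousOn_lowerTerm (ρ := ρ) (lam := lam) (θ := θ)
      (q := q) hτ1 h₂.1).1 hφ
    have e1 : ∀ x, ⟪gradient (fun x => M * u₂ x - u₁ x) x, gradient φ x⟫
        = M * ⟪gradient u₂ x, gradient φ x⟫ - ⟪gradient u₁ x, gradient φ x⟫ := by
      intro x
      by_cases hx : x = 0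
      · have : gradient φ x = 0 := image_eq_zero_of_notMem_tsupport fun h =>
          (hφ.2.2 (isTestFun_tsupport_gradient φ h)).2 hx
        simp [this]
      · rw [hgr x hx, inner_sub_left, inner_smul_left]; simp
    have e2 : ∀ x, (M * lowerTerm ρ lam τ θ q u₂ x - lowerTerm ρ lam τ θ q u₁ x) * φ x
        = M * (lowerTerm ρ lam τ θ q u₂ x * φ x) - lowerTerm ρ lam τ θ q u₁ x * φ x := by
      intro x; ring
    simp_rw [e1, e2]
    rw [integral_sub (i₂.const_mul M) i₁, integral_sub (j₂.const_mul M) j₁, integral_const_mul,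
      integral_const_mul]
    linear_combination M * w₂ - w₁
  · have hu2 := hp₂ x₀ hx₀
    have hG : Gt τ x₀ (u₁ x₀) (gradient u₁ x₀) = M * Gt τ x₀ (u₂ x₀) (gradient u₂ x₀) := by
      unfold Gt
      rw [← hMx, hgx, norm_smul, norm_of_nonneg hM0.le, mul_rpow hM0.le hu2.le,
        mul_rpow hM0.le (norm_nonneg _)]
      have : M ^ τ * M ^ (1 - τ) = M := by
        rw [← rpow_add hM0]; simp
      linear_combination (u₂ x₀ ^ τ * ‖gradient u₂ x₀‖ ^ (1 - τ) / ‖x₀‖ ^ (τ + 1)) * this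
    have hI : ⟪x₀, gradient u₁ x₀⟫ = M * ⟪x₀, gradient u₂ x₀⟫ := by
      rw [hgx, inner_smul_right]
    have hpw : M < M ^ q := by
      conv_lhs => rw [← rpow_one M]
      exact rpow_lt_rpow_of_exponent_lt hM1 hq
    have hxp : 0 < ‖x₀‖ ^ θ := rpow_pos_of_pos (norm_pos_iff.mpr hx₀) _
    have hup : 0 < u₂ x₀ ^ q := rpow_pos_of_pos hu2 _
    have : M * lowerTerm ρ lam τ θ q u₂ x₀ - lowerTerm ρ lam τ θ q u₁ x₀
        = (M - M ^ q) * (‖x₀‖ ^ θ * u₂ x₀ ^ q) := by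
      unfold lowerTerm
      rw [hG, hI, ← hMx, mul_rpow hM0.le hu2.le]; ring
    rw [this]
    exact mul_neg_of_neg_of_pos (by linarith) (by positivity)

end Comparison

section Radial

variable {N : ℕ}

theorem hasFDerivAt_comp_log_norm {g : ℝ → ℝ} {g' : ℝ} {x : EuclideanSpace ℝ (Fin N)}
    (hx : x ≠ 0) (hg : HasDerivAt g g' (log ‖x‖)) :
    HasFDerivAt (fun x : EuclideanSpace ℝ (Fin N) => g (log ‖x‖))
      ((g' / ‖x‖ ^ 2) • innerSL ℝ x) x := by
  have hn : ‖x‖ ^ 2 ≠ 0 := by simpa using hx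
  have h1 : HasFDerivAt (fun x : EuclideanSpace ℝ (Fin N) => log ‖x‖)
      ((1 / ‖x‖ ^ 2) • innerSL ℝ x) x := by
    have h2 := ((hasFDerivAt_id x).norm_sq.log hn).const_mul (1 / 2 : ℝ)
    have h3 : (fun x : EuclideanSpace ℝ (Fin N) => log ‖x‖)
        = fun x => 1 / 2 * log (‖id x‖ ^ 2) := by
      ext y; rw [log_pow]; simp
    rw [h3]
    refine h2.congr_fderiv ?_
    ext v; simp; ring
  refine (hg.comp_hasFDerivAt x h1).congr_fderiv ?_
  ext v; simp; ring

theorem contDiffOn_comp_log_norm {g : ℝ → ℝ} (hg : ContDiff ℝ 1 g) :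
    ContDiffOn ℝ 1 (fun x : EuclideanSpace ℝ (Fin N) => g (log ‖x‖)) (Set.univ \ {0}) := by
  refine hg.comp_contDiffOn ?_
  exact ContDiffOn.log (fun x hx => (contDiffAt_norm ℝ hx.2).contDiffWithinAt)
    fun x hx => by simpa using hx.2

theorem contDiff_one_of_hasDerivAt {g g' : ℝ → ℝ} (h : ∀ t, HasDerivAt g (g' t) t)
    (hc : Continuous g') : ContDiff ℝ 1 g := by
  rw [contDiff_one_iff_deriv]
  refine ⟨fun t => (h t).differentiableAt, ?_⟩
  rwa [show deriv g = g' from funext fun t => (h t).deriv]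

/-- Solutions of the radial equation in the logarithmic variable give solutions of (E). -/
theorem isSolutionE_of_log_radial {ρ lam τ θ q a : ℝ} (hN : 2 ≤ N) (hτ1 : τ < 1)
    (ha : (q - 1) * a = -(θ + 2)) {ℓ p : ℝ → ℝ} (hℓ : ∀ t, HasDerivAt ℓ (p t) t)
    (hp : ∀ t, HasDerivAt p
      (exp ((q - 1) * (ℓ t - a * t)) - (p t ^ 2 - 2 * ρ * p t + lam * p t ^ (1 - τ))) t)
    (hpos : ∀ t, 0 < p t) :
    IsSolutionE N ρ lam τ θ q Set.univ
      (fun x : EuclideanSpace ℝ (Fin N) => exp (ℓ (log ‖x‖))) := by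
  set u := fun x : EuclideanSpace ℝ (Fin N) => exp (ℓ (log ‖x‖)) with hu
  have hpc : Continuous p := continuous_iff_continuousAt.mpr fun t => (hp t).continuousAt
  have hℓc : Continuous ℓ := continuous_iff_continuousAt.mpr fun t => (hℓ t).continuousAt
  have hℓC : ContDiff ℝ 1 fun t => exp (ℓ t) := (contDiff_one_of_hasDerivAt hℓ hpc).exp
  have hC : PosC1 Set.univ u := ⟨contDiffOn_comp_log_norm hℓC, fun x _ => exp_pos _⟩
  refine ⟨hC, fun φ hφ => ?_⟩
  rw [weakE_eq hN hτ1 hC hφ]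
  set K : ℝ → ℝ := fun t => exp (ℓ t - 2 * t) * p t with hK
  set K' : ℝ → ℝ := fun t => exp (ℓ t - 2 * t) * (p t - 2) * p t + exp (ℓ t - 2 * t) *
    (exp ((q - 1) * (ℓ t - a * t)) - (p t ^ 2 - 2 * ρ * p t + lam * p t ^ (1 - τ))) with hK'
  have hKd : ∀ t, HasDerivAt K (K' t) t := fun t => by
    have h1 : HasDerivAt (fun t => ℓ t - 2 * t) (p t - 2) t := by
      simpa using (hℓ t).fun_sub ((hasDerivAt_id' t).const_mul 2)
    exact h1.exp.mul (hp t)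
  have hK'c : Continuous K' := by
    have : Continuous fun t => p t ^ (1 - τ) := hpc.rpow_const fun t => Or.inl (hpos t).ne'
    rw [hK']; fun_prop
  have hKC : ContDiff ℝ 1 K := contDiff_one_of_hasDerivAt hKd hK'c
  have hkC := contDiffOn_comp_log_norm (N := N) hKC
  have hU : IsOpen ((Set.univ : Set (EuclideanSpace ℝ (Fin N))) \ {0}) :=
    isOpen_univ.sdiff isClosed_singleton
  have hgrad : ∀ x, x ≠ 0 → gradient u x = K (log ‖x‖) • x := by
    intro x hx
    have h1 := hasFDerivAt_comp_log_norm hx (g := fun t => exp (ℓ t)) (hℓ (log ‖x‖)).exp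
    apply (InnerProductSpace.toDual ℝ (EuclideanSpace ℝ (Fin N))).injective
    rw [gradient, LinearIsometryEquiv.apply_symm_apply, h1.fderiv]
    have hxn : 0 < ‖x‖ := norm_pos_iff.mpr hx
    have h2 : exp (2 * log ‖x‖) = ‖x‖ ^ 2 := by
      rw [two_mul, exp_add, exp_log hxn]; ring
    ext v
    simp [hK, exp_sub, h2, mul_div_right_comm]
  have hψts : tsupport (fun x => K (log ‖x‖) * φ x) ⊆ tsupport φ :=
    closure_mono (Function.support_mul_subset_right _ _)
  have hψ : ContDiff ℝ 1 fun x => K (log ‖x‖) * φ x := by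
    rw [contDiff_iff_contDiffAt]
    intro x
    by_cases hx : x = 0
    · have hx' : x ∉ tsupport fun x => K (log ‖x‖) * φ x := fun h => (hφ.2.2 (hψts h)).2 hx
      exact contDiffAt_const.congr_of_eventuallyEq (notMem_tsupport_iff_eventuallyEq.mp hx')
    · exact (hkC.contDiffAt (hU.mem_nhds ⟨trivial, hx⟩)).mul hφ.1.contDiffAt
  have hψc : HasCompactSupport fun x => K (log ‖x‖) * φ x := hφ.2.1.mul_left
  have hφ0 : ∀ x, x = 0 → φ x = 0 ∧ fderiv ℝ φ x = 0 := fun x hx =>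
    ⟨image_eq_zero_of_notMem_tsupport fun h => (hφ.2.2 h).2 hx,
      image_eq_zero_of_notMem_tsupport fun h => (hφ.2.2 (tsupport_fderiv_subset ℝ h)).2 hx⟩
  have e1 : ∀ x, ⟪gradient u x, gradient φ x⟫
      = fderiv ℝ (fun x => K (log ‖x‖) * φ x) x (x - 0) - K' (log ‖x‖) * φ x := by
    intro x
    rw [real_inner_comm, inner_gradient_eq]
    by_cases hx : x = 0
    · rw [(hφ0 x hx).1, (hφ0 x hx).2]
      simp [hx]
    · have hk := hasFDerivAt_comp_log_norm hx (hKd (log ‖x‖))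
      have hφd := (hφ.1.differentiable one_ne_zero x).hasFDerivAt
      rw [(hk.fun_mul hφd).fderiv, hgrad x hx]
      have : ‖x‖ ≠ 0 := by simpa using hx
      simp
      field_simp
      ring
  have e2 : ∀ x, lowerTerm ρ lam τ θ q u x * φ x
      = (N : ℝ) * (K (log ‖x‖) * φ x) + K' (log ‖x‖) * φ x := by
    intro x
    by_cases hx : x = 0
    · simp [(hφ0 x hx).1]
    · have hxn : 0 < ‖x‖ := norm_pos_iff.mpr hx
      obtain ⟨t, ht⟩ : ∃ t, ‖x‖ = exp t := ⟨log ‖x‖, (exp_log hxn).symm⟩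
      rw [← mul_assoc, ← add_mul]
      congr 1
      unfold lowerTerm Gt
      rw [hgrad x hx, inner_smul_right, real_inner_self_eq_norm_sq, norm_smul, hu]
      simp only [ht, log_exp]
      have hKp : 0 < K t := mul_pos (exp_pos _) (hpos t)
      have g1 : ‖K t‖ * exp t = exp (ℓ t - t) * p t := by
        rw [norm_of_nonneg hKp.le, hK]
        simp only
        rw [mul_right_comm, ← exp_add]; ring_nf
      have g2 : exp (ℓ t) ^ τ * (exp (ℓ t - t) * p t) ^ (1 - τ) / exp t ^ (τ + 1)
          = exp (ℓ t - 2 * t) * p t ^ (1 - τ) := by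
        rw [mul_rpow (exp_pos _).le (hpos t).le, ← exp_mul, ← exp_mul, ← exp_mul, ← mul_assoc,
          ← exp_add, mul_div_right_comm, ← exp_sub]
        ring_nf
      have g3 : exp t ^ θ * exp (ℓ t) ^ q
          = exp (ℓ t - 2 * t) * exp ((q - 1) * (ℓ t - a * t)) := by
        rw [← exp_mul, ← exp_mul, ← exp_add, ← exp_add]
        congr 1
        linear_combination t * ha
      rw [g1, g2, g3, mul_div_assoc, div_self (pow_ne_zero _ (exp_pos t).ne')]
      simp only [hK, hK']
      ring
  simp_rw [e1, e2]
  have hK'k : ContinuousOn (fun x : EuclideanSpace ℝ (Fin N) => K' (log ‖x‖))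
      (Set.univ \ {0}) := hK'c.comp_continuousOn
    (ContinuousOn.log continuous_norm.continuousOn fun x hx => by simpa using hx.2)
  have i1 := integrable_mul_testFun hK'k hφ
  have i2 : Integrable fun x => K (log ‖x‖) * φ x :=
    hψ.continuous.integrable_of_hasCompactSupport hψc
  have i3 : Integrable fun x => fderiv ℝ (fun x => K (log ‖x‖) * φ x) x (x - 0) := by
    refine Continuous.integrable_of_hasCompactSupport
      ((hψ.continuous_fderiv one_ne_zero).clm_apply (by fun_prop))
      (HasCompactSupport.intro hψc ?_)
    intro x hx
    have : fderiv ℝ (fun x => K (log ‖x‖) * φ x) x = 0 := image_eq_zero_of_notMem_tsupport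
        fun h => hx (tsupport_fderiv_subset ℝ h)
    simp [this]
  rw [integral_sub i3 i1, integral_add (i2.const_mul _) i1, integral_const_mul,
    integral_fderiv_apply_sub hψ hψc]
  ring

end Radial

/-- The Gronwall inequality on `[0, T]` in differential form. -/
theorem le_mul_exp_of_hasDerivWithinAt {n n' : ℝ → ℝ} {T C : ℝ}
    (h : ∀ t ∈ Set.Icc 0 T, HasDerivWithinAt n (n' t) (Set.Icc 0 T) t)
    (hle : ∀ t ∈ Set.Icc 0 T, n' t ≤ C * n t) :
    ∀ t ∈ Set.Icc 0 T, n t ≤ n 0 * exp (C * t) := by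
  intro t ht
  have hd : ∀ s ∈ Set.Icc 0 T, HasDerivWithinAt (fun s => n s * exp (-(C * s)))
      (n' s * exp (-(C * s)) + n s * (exp (-(C * s)) * -(C * 1))) (Set.Icc 0 T) s := fun s hs =>
    (h s hs).fun_mul (((hasDerivAt_id s).const_mul C).neg.exp.hasDerivWithinAt)
  have hanti : AntitoneOn (fun s => n s * exp (-(C * s))) (Set.Icc 0 T) := by
    refine antitoneOn_of_hasDerivWithinAt_nonpos (convex_Icc 0 T)
      (fun s hs => (hd s hs).continuousWithinAt)
      (fun s hs => (hd s (interior_subset hs)).mono interior_subset) fun s hs => ?_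
    have h1 := hle s (interior_subset hs)
    have := mul_le_mul_of_nonneg_right h1 (exp_pos (-(C * s))).le
    linarith
  have h1 := hanti ⟨le_rfl, ht.1.trans ht.2⟩ ht ht.1
  simp only [mul_zero, neg_zero, exp_zero, mul_one] at h1
  calc n t = n t * exp (-(C * t)) * exp (C * t) := by
        rw [mul_assoc, ← exp_add]; simp
    _ ≤ n 0 * exp (C * t) := mul_le_mul_of_nonneg_right h1 (exp_pos _).le

theorem exp_sub_exp_le (x y : ℝ) : exp x - exp y ≤ exp x * (x - y) := by
  have h := add_one_le_exp (y - x)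
  have : exp y = exp x * exp (y - x) := by rw [← exp_add]; ring_nf
  rw [this]
  nlinarith [exp_pos x]

theorem abs_exp_sub_exp_le {x y c : ℝ} (hx : exp x ≤ c) (hy : exp y ≤ c) :
    |exp x - exp y| ≤ c * |x - y| := by
  rcases le_total y x with h | h
  · rw [abs_of_nonneg (sub_nonneg.mpr (exp_le_exp.mpr h)), abs_of_nonneg (sub_nonneg.mpr h)]
    exact (exp_sub_exp_le x y).trans (mul_le_mul_of_nonneg_right hx (sub_nonneg.mpr h))
  · rw [abs_sub_comm, abs_sub_comm x, abs_of_nonneg (sub_nonneg.mpr (exp_le_exp.mpr h)),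
      abs_of_nonneg (sub_nonneg.mpr h)]
    exact (exp_sub_exp_le y x).trans (mul_le_mul_of_nonneg_right hy (sub_nonneg.mpr h))

/-- `(y, z)` solves `dy/dt = e^z - F(y)`, `dz/dt = -m(α - y)` on `[0, T]`, with `0 < y ≤ α`. -/
structure IsOrbitOn (m α : ℝ) (F y z : ℝ → ℝ) (T : ℝ) : Prop where
  deriv_y : ∀ t ∈ Set.Icc 0 T, HasDerivWithinAt y (exp (z t) - F (y t)) (Set.Icc 0 T) t
  deriv_z : ∀ t ∈ Set.Icc 0 T, HasDerivWithinAt z (-(m * (α - y t))) (Set.Icc 0 T) t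
  pos : ∀ t ∈ Set.Icc 0 T, 0 < y t
  le : ∀ t ∈ Set.Icc 0 T, y t ≤ α

/-- `F` is locally Lipschitz on `(0, α]` and tends to `0` at `0`. -/
structure IsAdmissible (F : ℝ → ℝ) (α : ℝ) : Prop where
  pos : 0 < α
  lipschitz : ∀ δ, 0 < δ → ∃ K, 0 ≤ K ∧ ∀ x ∈ Set.Icc δ α, ∀ y ∈ Set.Icc δ α,
    |F x - F y| ≤ K * |x - y|
  tendsto : Tendsto F (𝓝[>] 0) (𝓝 0)

namespace IsOrbitOn

variable {m α T : ℝ} {F y z y₁ z₁ y₂ z₂ : ℝ → ℝ}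

theorem mono (h : IsOrbitOn m α F y z T) {S : ℝ} (hS : S ≤ T) : IsOrbitOn m α F y z S := by
  have hs : Set.Icc 0 S ⊆ Set.Icc 0 T := Set.Icc_subset_Icc_right hS
  exact ⟨fun t ht => (h.deriv_y t (hs ht)).mono hs, fun t ht => (h.deriv_z t (hs ht)).mono hs,
    fun t ht => h.pos t (hs ht), fun t ht => h.le t (hs ht)⟩

theorem congr (h : IsOrbitOn m α F y₁ z₁ T) (hy : Set.EqOn y₂ y₁ (Set.Icc 0 T))
    (hz : Set.EqOn z₂ z₁ (Set.Icc 0 T)) : IsOrbitOn m α F y₂ z₂ T := by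
  refine ⟨fun t ht => ?_, fun t ht => ?_, fun t ht => ?_, fun t ht => ?_⟩
  · rw [hy ht, hz ht]; exact (h.deriv_y t ht).congr hy (hy ht)
  · rw [hy ht]; exact (h.deriv_z t ht).congr hz (hz ht)
  · rw [hy ht]; exact h.pos t ht
  · rw [hy ht]; exact h.le t ht

theorem exists_lower_bound (h : IsOrbitOn m α F y z T) (hT : 0 ≤ T) :
    ∃ δ, 0 < δ ∧ ∀ t ∈ Set.Icc 0 T, δ ≤ y t := by
  have hc : ContinuousOn y (Set.Icc 0 T) := fun t ht => (h.deriv_y t ht).continuousWithinAt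
  obtain ⟨s, hs, hmin⟩ := isCompact_Icc.exists_isMinOn ⟨0, le_rfl, hT⟩ hc
  exact ⟨y s, h.pos s hs, fun t ht => hmin ht⟩

theorem exp_le (hm : 0 ≤ m) (h : IsOrbitOn m α F y z T) :
    ∀ t ∈ Set.Icc 0 T, exp (z t) ≤ exp (z 0) := by
  intro t ht
  have := le_mul_exp_of_hasDerivWithinAt (C := 0) h.deriv_z (fun s hs => by
    have := mul_nonneg hm (sub_nonneg.mpr (h.le s hs)); linarith) t ht
  exact exp_le_exp.mpr (by simpa using this)

/-- The system is cooperative: orbits with ordered initial data stay ordered. -/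
theorem le_of_le (hF : IsAdmissible F α) (hm : 0 ≤ m) (h₁ : IsOrbitOn m α F y₁ z₁ T)
    (h₂ : IsOrbitOn m α F y₂ z₂ T) (hy : y₁ 0 ≤ y₂ 0) (hz : z₁ 0 ≤ z₂ 0) :
    ∀ t ∈ Set.Icc 0 T, y₁ t ≤ y₂ t ∧ z₁ t ≤ z₂ t := by
  intro t ht
  have hT : 0 ≤ T := ht.1.trans ht.2
  obtain ⟨δ₁, hδ₁, hl₁⟩ := h₁.exists_lower_bound hT
  obtain ⟨δ₂, hδ₂, hl₂⟩ := h₂.exists_lower_bound hT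
  obtain ⟨K, hK, hLip⟩ := hF.lipschitz (min δ₁ δ₂) (lt_min hδ₁ hδ₂)
  set c := exp (z₁ 0)
  have hc : 0 < c := exp_pos _
  set n : ℝ → ℝ := fun t => max (y₁ t - y₂ t) 0 ^ 2 + max (z₁ t - z₂ t) 0 ^ 2
  have hd : ∀ s ∈ Set.Icc 0 T, HasDerivWithinAt n
      (2 * max (y₁ s - y₂ s) 0 * ((exp (z₁ s) - F (y₁ s)) - (exp (z₂ s) - F (y₂ s)))
        + 2 * max (z₁ s - z₂ s) 0 * (-(m * (α - y₁ s)) - -(m * (α - y₂ s)))) (Set.Icc 0 T) s :=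
    fun s hs => ((hasDerivAt_max_zero_sq _).comp_hasDerivWithinAt s
      ((h₁.deriv_y s hs).fun_sub (h₂.deriv_y s hs))).fun_add
      ((hasDerivAt_max_zero_sq _).comp_hasDerivWithinAt s
      ((h₁.deriv_z s hs).fun_sub (h₂.deriv_z s hs)))
  have hn := le_mul_exp_of_hasDerivWithinAt (C := c + m + 2 * K) hd (fun s hs => by
    have hA0 : 0 ≤ max (y₁ s - y₂ s) 0 := le_max_right _ _
    have hB0 : 0 ≤ max (z₁ s - z₂ s) 0 := le_max_right _ _
    have hA1 : y₁ s - y₂ s ≤ max (y₁ s - y₂ s) 0 := le_max_left _ _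
    have hB1 : z₁ s - z₂ s ≤ max (z₁ s - z₂ s) 0 := le_max_left _ _
    have hA2 : max (y₁ s - y₂ s) 0 * |y₁ s - y₂ s| = max (y₁ s - y₂ s) 0 ^ 2 := by
      rcases le_total (y₁ s - y₂ s) 0 with h | h
      · rw [max_eq_right h]; simp
      · rw [max_eq_left h, abs_of_nonneg h]; ring
    have hexp : exp (z₁ s) - exp (z₂ s) ≤ c * max (z₁ s - z₂ s) 0 := by
      refine (exp_sub_exp_le _ _).trans ?_
      exact (mul_le_mul_of_nonneg_left hB1 (exp_pos _).le).trans
        (mul_le_mul_of_nonneg_right (h₁.exp_le hm s hs) hB0)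
    have hFd := hLip (y₁ s) ⟨(min_le_left _ _).trans (hl₁ s hs), h₁.le s hs⟩
      (y₂ s) ⟨(min_le_right _ _).trans (hl₂ s hs), h₂.le s hs⟩
    have hFd' : -(F (y₁ s) - F (y₂ s)) ≤ K * |y₁ s - y₂ s| := (neg_le_abs _).trans hFd
    simp only [n]
    set A := max (y₁ s - y₂ s) 0
    set B := max (z₁ s - z₂ s) 0
    have e1 := mul_le_mul_of_nonneg_left hexp hA0
    have e2 := mul_le_mul_of_nonneg_left hFd' hA0
    have e3 := mul_le_mul_of_nonneg_left hA1 (mul_nonneg hm hB0)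
    have e4 : A * (K * |y₁ s - y₂ s|) = K * A ^ 2 := by rw [← hA2]; ring
    have e5 : 0 ≤ (c + m) * (A - B) ^ 2 := by positivity
    have e6 : 0 ≤ K * B ^ 2 := by positivity
    nlinarith) t ht
  have hn0 : n 0 = 0 := by
    simp only [n]
    rw [max_eq_right (by linarith), max_eq_right (by linarith)]; norm_num
  rw [hn0, zero_mul] at hn
  have hq1 : 0 ≤ max (y₁ t - y₂ t) 0 ^ 2 := by positivity
  have hq2 : 0 ≤ max (z₁ t - z₂ t) 0 ^ 2 := by positivity
  have hz1 : max (y₁ t - y₂ t) 0 = 0 := pow_eq_zero_iff (two_ne_zero) |>.mp (by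
    simp only [n] at hn; linarith)
  have hz2 : max (z₁ t - z₂ t) 0 = 0 := pow_eq_zero_iff (two_ne_zero) |>.mp (by
    simp only [n] at hn; linarith)
  exact ⟨by linarith [max_eq_right_iff.mp hz1], by linarith [max_eq_right_iff.mp hz2]⟩

/-- Lipschitz dependence on the initial data for orbits staying above a fixed level. -/
theorem exists_dist_le (hF : IsAdmissible F α) (hm : 0 ≤ m) {δ ζ : ℝ} (hδ : 0 < δ) (T : ℝ) :
    ∃ C : ℝ, ∀ y₁ z₁ y₂ z₂, IsOrbitOn m α F y₁ z₁ T → IsOrbitOn m α F y₂ z₂ T →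
      z₁ 0 ≤ ζ → z₂ 0 ≤ ζ → (∀ t ∈ Set.Icc 0 T, δ ≤ y₁ t) → (∀ t ∈ Set.Icc 0 T, δ ≤ y₂ t) →
      y₁ 0 = y₂ 0 → ∀ t ∈ Set.Icc 0 T, (z₁ t - z₂ t) ^ 2 ≤ (z₁ 0 - z₂ 0) ^ 2 * exp (C * t) := by
  obtain ⟨K, hK, hLip⟩ := hF.lipschitz δ hδ
  set c := exp ζ
  have hc : 0 < c := exp_pos _
  refine ⟨c + m + 2 * K, ?_⟩
  intro y₁ z₁ y₂ z₂ h₁ h₂ hz₁ hz₂ hl₁ hl₂ hy0 t ht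
  set n : ℝ → ℝ := fun t => (y₁ t - y₂ t) ^ 2 + (z₁ t - z₂ t) ^ 2
  have hd : ∀ s ∈ Set.Icc 0 T, HasDerivWithinAt n
      (2 * (y₁ s - y₂ s) * ((exp (z₁ s) - F (y₁ s)) - (exp (z₂ s) - F (y₂ s)))
        + 2 * (z₁ s - z₂ s) * (-(m * (α - y₁ s)) - -(m * (α - y₂ s)))) (Set.Icc 0 T) s :=
    fun s hs => by
      simpa using (((h₁.deriv_y s hs).fun_sub (h₂.deriv_y s hs)).fun_pow 2).fun_add
        (((h₁.deriv_z s hs).fun_sub (h₂.deriv_z s hs)).fun_pow 2)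
  have hn := le_mul_exp_of_hasDerivWithinAt (C := c + m + 2 * K) hd (fun s hs => by
    have hexp := abs_exp_sub_exp_le ((h₁.exp_le hm s hs).trans (exp_le_exp.mpr hz₁))
      ((h₂.exp_le hm s hs).trans (exp_le_exp.mpr hz₂))
    have hFd := hLip (y₁ s) ⟨hl₁ s hs, h₁.le s hs⟩ (y₂ s) ⟨hl₂ s hs, h₂.le s hs⟩
    simp only [n]
    set A := y₁ s - y₂ s with hA
    set B := z₁ s - z₂ s
    have e1 : A * (exp (z₁ s) - exp (z₂ s)) ≤ |A| * (c * |B|) :=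
      (le_abs_self _).trans (by
        rw [abs_mul]; exact mul_le_mul_of_nonneg_left hexp (abs_nonneg _))
    have e2 : -(A * (F (y₁ s) - F (y₂ s))) ≤ |A| * (K * |A|) :=
      (neg_le_abs _).trans (by
        rw [abs_mul]; exact mul_le_mul_of_nonneg_left hFd (abs_nonneg _))
    have e3 : m * (A * B) ≤ m * (|A| * |B|) :=
      mul_le_mul_of_nonneg_left ((le_abs_self _).trans (abs_mul _ _).le) hm
    have e5 : 0 ≤ (c + m) * (|A| - |B|) ^ 2 := by positivity
    have e6 : 0 ≤ K * B ^ 2 := by positivity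
    have e7 := sq_abs A
    have e8 := sq_abs B
    have e9 : -(m * (α - y₁ s)) - -(m * (α - y₂ s)) = m * A := by rw [hA]; ring
    rw [e9]
    nlinarith) t ht
  have : n 0 = (z₁ 0 - z₂ 0) ^ 2 := by simp [n, hy0]
  rw [← this]
  refine le_trans ?_ hn
  simp only [n]
  nlinarith [sq_nonneg (y₁ t - y₂ t)]

end IsOrbitOn

/-- A bounded Lipschitz autonomous vector field has integral curves on `[0, T]`. -/
theorem exists_integralCurve_of_lipschitz_bounded {E : Type*} [NormedAddCommGroup E]
    [NormedSpace ℝ E] [CompleteSpace E] {V : E → E} {K L : NNReal} (hV : LipschitzWith K V)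
    (hL : ∀ x, ‖V x‖ ≤ L) (x₀ : E) {T : ℝ} (hT : 0 ≤ T) :
    ∃ γ : ℝ → E, γ 0 = x₀ ∧
      ∀ t ∈ Set.Icc 0 T, HasDerivWithinAt γ (V (γ t)) (Set.Icc 0 T) t := by
  have h : IsPicardLindelof (fun _ => V) (⟨0, Set.left_mem_Icc.mpr hT⟩ : Set.Icc 0 T) x₀
      (L * T.toNNReal) 0 L K :=
    { lipschitzOnWith := fun t _ => hV.lipschitzOnWith
      continuousOn := fun x _ => continuousOn_const
      norm_le := fun t _ x _ => hL x
      mul_max_le := by simp [hT, NNReal.coe_mul] }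
  exact h.exists_eq_forall_mem_Icc_hasDerivWithinAt₀

namespace IsOrbitOn

variable {m α T : ℝ} {F y z y₁ z₁ y₂ z₂ : ℝ → ℝ}

theorem exists_on_Icc (hF : IsAdmissible F α) (hm : 0 ≤ m) {ζ : ℝ} (hζ : exp ζ ≤ F α)
    (hT : 0 ≤ T) : ∃ y z, y 0 = α ∧ z 0 = ζ ∧ IsOrbitOn m α F y z T := by
  have hα := hF.pos
  obtain ⟨δ, ⟨hδ, hδα⟩, hFδ⟩ : ∃ δ, (0 < δ ∧ δ < α) ∧ F δ ≤ exp (ζ - m * α * T) := by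
    have h1 := hF.tendsto.eventually (Iic_mem_nhds (exp_pos (ζ - m * α * T)))
    have h2 : ∀ᶠ x in 𝓝[>] (0 : ℝ), x ∈ Set.Ioo 0 α := Ioo_mem_nhdsGT hα
    obtain ⟨δ, h3, h4⟩ := (h1.and h2).exists
    exact ⟨δ, h4, h3⟩
  obtain ⟨K, hK, hLip⟩ := hF.lipschitz δ hδ
  set cl : ℝ → ℝ := fun y => max (min y α) δ with hcl
  have hcl_mem : ∀ y, cl y ∈ Set.Icc δ α := fun y =>
    ⟨le_max_right _ _, max_le (min_le_right _ _) hδα.le⟩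
  have hcl_lip : ∀ y y', |cl y - cl y'| ≤ |y - y'| := fun y y' =>
    (abs_max_sub_max_le_abs _ _ _).trans (by simpa using abs_min_sub_min_le_max y α y' α)
  set V : ℝ × ℝ → ℝ × ℝ := fun p =>
    (exp (min p.2 ζ) - F (cl p.1), -(m * (α - cl p.1))) with hVdef
  have hV : LipschitzWith (Real.toNNReal (exp ζ + K + m)) V := by
    refine LipschitzWith.of_dist_le' fun p p' => ?_
    have hp1 : |p.1 - p'.1| ≤ dist p p' := by
      rw [← Real.dist_eq]; exact le_max_left _ _
    have hp2 : |p.2 - p'.2| ≤ dist p p' := by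
      rw [← Real.dist_eq]; exact le_max_right _ _
    have hd : 0 ≤ dist p p' := dist_nonneg
    have e1 : |exp (min p.2 ζ) - exp (min p'.2 ζ)| ≤ exp ζ * dist p p' :=
      (abs_exp_sub_exp_le (exp_le_exp.mpr (min_le_right _ _))
        (exp_le_exp.mpr (min_le_right _ _))).trans
        (mul_le_mul_of_nonneg_left (le_trans
          (by simpa using abs_min_sub_min_le_max p.2 ζ p'.2 ζ) hp2) (exp_pos _).le)
    have e2 : |F (cl p.1) - F (cl p'.1)| ≤ K * dist p p' :=
      (hLip _ (hcl_mem _) _ (hcl_mem _)).trans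
        (mul_le_mul_of_nonneg_left ((hcl_lip _ _).trans hp1) hK)
    have e3 : m * |cl p.1 - cl p'.1| ≤ m * dist p p' :=
      mul_le_mul_of_nonneg_left ((hcl_lip _ _).trans hp1) hm
    have e4 : 0 ≤ exp ζ * dist p p' := mul_nonneg (exp_pos _).le hd
    have e5 : 0 ≤ K * dist p p' := mul_nonneg hK hd
    have e6 : 0 ≤ m * dist p p' := mul_nonneg hm hd
    rw [Prod.dist_eq]
    refine max_le ?_ ?_
    · simp only [hVdef, Real.dist_eq]
      have : exp (min p.2 ζ) - F (cl p.1) - (exp (min p'.2 ζ) - F (cl p'.1))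
        = (exp (min p.2 ζ) - exp (min p'.2 ζ)) - (F (cl p.1) - F (cl p'.1)) := by ring
      rw [this]
      refine (abs_sub _ _).trans ?_
      nlinarith
    · simp only [hVdef, Real.dist_eq]
      have : -(m * (α - cl p.1)) - -(m * (α - cl p'.1)) = m * (cl p.1 - cl p'.1) := by ring
      rw [this, abs_mul, abs_of_nonneg hm]
      nlinarith
  have hL : ∀ p, ‖V p‖ ≤ Real.toNNReal (exp ζ + |F α| + K * α + m * α) := by
    intro p
    have hmem := hcl_mem p.1
    have hαm : α ∈ Set.Icc δ α := ⟨hδα.le, le_rfl⟩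
    have hab : |α - cl p.1| ≤ α := by
      rw [abs_of_nonneg (by linarith [hmem.2])]; linarith [hmem.1]
    have e1 : |F α - F (cl p.1)| ≤ K * α :=
      (hLip _ hαm _ hmem).trans (mul_le_mul_of_nonneg_left hab hK)
    have e2 : |exp (min p.2 ζ)| ≤ exp ζ := by
      rw [abs_of_pos (exp_pos _)]; exact exp_le_exp.mpr (min_le_right _ _)
    have e3 : m * |α - cl p.1| ≤ m * α := mul_le_mul_of_nonneg_left hab hm
    have e4 : 0 ≤ K * α := mul_nonneg hK hα.le
    have e5 : 0 ≤ m * α := mul_nonneg hm hα.le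
    have e6 := abs_nonneg (F α)
    have e7 := exp_pos ζ
    rw [Real.coe_toNNReal _ (by positivity), Prod.norm_def]
    refine max_le ?_ ?_
    · simp only [hVdef, Real.norm_eq_abs]
      have : exp (min p.2 ζ) - F (cl p.1) = exp (min p.2 ζ) - F α + (F α - F (cl p.1)) := by ring
      rw [this]
      have h1 := abs_add_le (exp (min p.2 ζ) - F α) (F α - F (cl p.1))
      have h2 := abs_sub (exp (min p.2 ζ)) (F α)
      linarith
    · simp only [hVdef, Real.norm_eq_abs, abs_neg, abs_mul, abs_of_nonneg hm]
      linarith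
  obtain ⟨γ, hγ0, hγ⟩ := exists_integralCurve_of_lipschitz_bounded hV hL (α, ζ) hT
  have hy : ∀ t ∈ Set.Icc 0 T, HasDerivWithinAt (fun t => (γ t).1)
      (exp (min (γ t).2 ζ) - F (cl (γ t).1)) (Set.Icc 0 T) t := fun t ht =>
    (hγ t ht).fst
  have hz : ∀ t ∈ Set.Icc 0 T, HasDerivWithinAt (fun t => (γ t).2)
      (-(m * (α - cl (γ t).1))) (Set.Icc 0 T) t := fun t ht =>
    (hγ t ht).snd
  have hzle : ∀ t ∈ Set.Icc 0 T, (γ t).2 ≤ ζ := by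
    intro t ht
    have := le_mul_exp_of_hasDerivWithinAt (C := 0) hz (fun s _ => by
      have := mul_nonneg hm (sub_nonneg.mpr (hcl_mem (γ s).1).2); linarith) t ht
    simpa [hγ0] using this
  have hzge : ∀ t ∈ Set.Icc 0 T, ζ - m * α * T ≤ (γ t).2 := by
    intro t ht
    have := le_mul_exp_of_hasDerivWithinAt (C := 0)
      (fun s hs => (((hasDerivAt_id s).const_mul (m * α)).hasDerivWithinAt.add (hz s hs)).neg)
      (fun s _ => by
        have := mul_nonneg hm (hδ.le.trans (hcl_mem (γ s).1).1); nlinarith) t ht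
    simp [hγ0] at this
    have h2 : m * α * t ≤ m * α * T := mul_le_mul_of_nonneg_left ht.2 (mul_nonneg hm hα.le)
    linarith
  have hyle : ∀ t ∈ Set.Icc 0 T, (γ t).1 ≤ α := by
    intro t ht
    have := le_mul_exp_of_hasDerivWithinAt (C := 0)
      (fun s hs => (hasDerivAt_max_zero_sq _).comp_hasDerivWithinAt s ((hy s hs).sub_const α))
      (fun s hs => by
        rw [zero_mul]
        rcases le_total (γ s).1 α with h | h
        · rw [max_eq_right (by linarith)]; simp
        · have hc : cl (γ s).1 = α := by
            simp only [hcl]; rw [min_eq_right h, max_eq_left hδα.le]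
          rw [hc]
          refine mul_nonpos_of_nonneg_of_nonpos (by positivity) ?_
          have := exp_le_exp.mpr (min_le_right (γ s).2 ζ)
          linarith) t ht
    simp [hγ0] at this
    exact this
  have hyge : ∀ t ∈ Set.Icc 0 T, δ ≤ (γ t).1 := by
    intro t ht
    have := le_mul_exp_of_hasDerivWithinAt (C := 0)
      (fun s hs => (hasDerivAt_max_zero_sq _).comp_hasDerivWithinAt s ((hy s hs).const_sub δ))
      (fun s hs => by
        rw [zero_mul]
        rcases le_total δ (γ s).1 with h | h
        · rw [max_eq_right (by linarith)]; simp
        · have hc : cl (γ s).1 = δ := by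
            simp only [hcl]; rw [min_eq_left (h.trans hδα.le), max_eq_right h]
          rw [hc]
          refine mul_nonpos_of_nonneg_of_nonpos (by positivity) ?_
          rw [min_eq_left (hzle s hs)]
          have := exp_le_exp.mpr (hzge s hs)
          linarith) t ht
    simp [hγ0, max_eq_right (sub_nonpos.mpr hδα.le)] at this
    exact this
  have hcl_eq : ∀ t ∈ Set.Icc 0 T, cl (γ t).1 = (γ t).1 := fun t ht => by
    simp only [hcl]; rw [min_eq_left (hyle t ht), max_eq_left (hyge t ht)]
  refine ⟨fun t => (γ t).1, fun t => (γ t).2, by simp [hγ0], by simp [hγ0],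
    fun t ht => ?_, fun t ht => ?_, fun t ht => hδ.trans_le (hyge t ht), hyle⟩
  · have := hy t ht
    rwa [hcl_eq t ht, min_eq_left (hzle t ht)] at this
  · have := hz t ht
    rwa [hcl_eq t ht] at this

end IsOrbitOn

/-- A global half-orbit starting at `(α, ζ)`. -/
structure IsHalfOrbit (m α : ℝ) (F : ℝ → ℝ) (ζ : ℝ) (y z : ℝ → ℝ) : Prop where
  y_zero : y 0 = α
  z_zero : z 0 = ζ
  orbit : ∀ T, IsOrbitOn m α F y z T

theorem exists_isHalfOrbit {m α ζ : ℝ} {F : ℝ → ℝ} (hF : IsAdmissible F α) (hm : 0 ≤ m)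
    (hζ : exp ζ ≤ F α) : ∃ y z, IsHalfOrbit m α F ζ y z := by
  have hex : ∀ n : ℕ, ∃ y z : ℝ → ℝ, y 0 = α ∧ z 0 = ζ ∧ IsOrbitOn m α F y z n := fun n =>
    IsOrbitOn.exists_on_Icc hF hm hζ n.cast_nonneg
  choose y z hy hz ho using hex
  have huniq : ∀ k n : ℕ, k ≤ n → ∀ t ∈ Set.Icc (0 : ℝ) k, y k t = y n t ∧ z k t = z n t := by
    intro k n hkn t ht
    have h1 := (ho k).le_of_le hF hm ((ho n).mono (Nat.cast_le.mpr hkn))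
      ((hy k).trans (hy n).symm).le ((hz k).trans (hz n).symm).le t ht
    have h2 := ((ho n).mono (Nat.cast_le.mpr hkn)).le_of_le hF hm (ho k)
      ((hy n).trans (hy k).symm).le ((hz n).trans (hz k).symm).le t ht
    exact ⟨le_antisymm h1.1 h2.1, le_antisymm h1.2 h2.2⟩
  refine ⟨fun t => y ⌈t⌉₊ t, fun t => z ⌈t⌉₊ t, by simp [hy], by simp [hz], fun T => ?_⟩
  have h1 := (ho ⌈T⌉₊).mono (Nat.le_ceil T)
  refine h1.congr (fun t ht => ?_) (fun t ht => ?_)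
  · exact (huniq _ _ (Nat.ceil_mono ht.2) t ⟨ht.1, Nat.le_ceil t⟩).1
  · exact (huniq _ _ (Nat.ceil_mono ht.2) t ⟨ht.1, Nat.le_ceil t⟩).2

theorem antitoneOn_Ici_of_hasDerivWithinAt {f f' : ℝ → ℝ} {a : ℝ}
    (h : ∀ t, a ≤ t → HasDerivWithinAt f (f' t) (Set.Ici a) t) (hle : ∀ t, a ≤ t → f' t ≤ 0) :
    AntitoneOn f (Set.Ici a) :=
  antitoneOn_of_hasDerivWithinAt_nonpos (convex_Ici a) (fun t ht => (h t ht).continuousWithinAt)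
    (fun t ht => (h t (interior_subset ht)).mono interior_subset)
    fun t ht => hle t (interior_subset ht)

namespace IsHalfOrbit

variable {m α ζ ζ₁ ζ₂ : ℝ} {F y z y₁ z₁ y₂ z₂ : ℝ → ℝ}

theorem pos (h : IsHalfOrbit m α F ζ y z) {t : ℝ} (ht : 0 ≤ t) : 0 < y t :=
  (h.orbit t).pos t ⟨ht, le_rfl⟩

theorem le (h : IsHalfOrbit m α F ζ y z) {t : ℝ} (ht : 0 ≤ t) : y t ≤ α :=
  (h.orbit t).le t ⟨ht, le_rfl⟩

theorem hasDerivWithinAt_y (h : IsHalfOrbit m α F ζ y z) {t : ℝ} (ht : 0 ≤ t) :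
    HasDerivWithinAt y (exp (z t) - F (y t)) (Set.Ici 0) t := by
  refine ((h.orbit (t + 1)).deriv_y t ⟨ht, by linarith⟩).mono_of_mem_nhdsWithin ?_
  rw [← Set.Ici_inter_Iic]
  exact inter_mem_nhdsWithin _ (Iic_mem_nhds (by linarith))

theorem hasDerivWithinAt_z (h : IsHalfOrbit m α F ζ y z) {t : ℝ} (ht : 0 ≤ t) :
    HasDerivWithinAt z (-(m * (α - y t))) (Set.Ici 0) t := by
  refine ((h.orbit (t + 1)).deriv_z t ⟨ht, by linarith⟩).mono_of_mem_nhdsWithin ?_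
  rw [← Set.Ici_inter_Iic]
  exact inter_mem_nhdsWithin _ (Iic_mem_nhds (by linarith))

theorem mono (hF : IsAdmissible F α) (hm : 0 ≤ m) (h₁ : IsHalfOrbit m α F ζ₁ y₁ z₁)
    (h₂ : IsHalfOrbit m α F ζ₂ y₂ z₂) (hζ : ζ₁ ≤ ζ₂) {t : ℝ} (ht : 0 ≤ t) :
    y₁ t ≤ y₂ t ∧ z₁ t ≤ z₂ t :=
  (h₁.orbit t).le_of_le hF hm (h₂.orbit t) (h₁.y_zero.trans h₂.y_zero.symm).le
    (by rwa [h₁.z_zero, h₂.z_zero]) t ⟨ht, le_rfl⟩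

theorem antitoneOn_sub (hF : IsAdmissible F α) (hm : 0 ≤ m) (h₁ : IsHalfOrbit m α F ζ₁ y₁ z₁)
    (h₂ : IsHalfOrbit m α F ζ₂ y₂ z₂) (hζ : ζ₁ ≤ ζ₂) :
    AntitoneOn (fun t => z₁ t - z₂ t) (Set.Ici 0) :=
  antitoneOn_Ici_of_hasDerivWithinAt
    (fun _ ht => (h₁.hasDerivWithinAt_z ht).fun_sub (h₂.hasDerivWithinAt_z ht))
    fun t ht => by nlinarith [mul_le_mul_of_nonneg_left (mono hF hm h₁ h₂ hζ ht).1 hm]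

theorem z_le (hm : 0 ≤ m) (h : IsHalfOrbit m α F ζ y z) {t : ℝ} (ht : 0 ≤ t) : z t ≤ ζ := by
  have := (h.orbit t).exp_le hm t ⟨ht, le_rfl⟩
  rwa [exp_le_exp, h.z_zero] at this

theorem orbit_shift (h : IsHalfOrbit m α F ζ y z) {s : ℝ} (hs : 0 ≤ s) (T : ℝ) :
    IsOrbitOn m α F (fun t => y (s + t)) (fun t => z (s + t)) T := by
  have hmap : Set.MapsTo (fun t => s + t) (Set.Icc 0 T) (Set.Ici 0) := fun t ht =>
    add_nonneg hs ht.1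
  refine ⟨fun t ht => ?_, fun t ht => ?_, fun t ht => h.pos (hmap ht),
    fun t ht => h.le (hmap ht)⟩
  · have := (h.hasDerivWithinAt_y (hmap ht)).comp t
      ((hasDerivAt_id t).const_add s).hasDerivWithinAt hmap
    simpa using! this
  · have := (h.hasDerivWithinAt_z (hmap ht)).comp t
      ((hasDerivAt_id t).const_add s).hasDerivWithinAt hmap
    simpa using! this

theorem antitoneOn_y (hF : IsAdmissible F α) (hm : 0 ≤ m) (h : IsHalfOrbit m α F ζ y z) :
    AntitoneOn y (Set.Ici 0) := by
  intro t ht t' _ htt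
  have h1 := (h.orbit_shift (sub_nonneg.mpr htt) t).le_of_le hF hm (h.orbit t)
    (by simpa [h.y_zero] using h.le (sub_nonneg.mpr htt))
    (by simpa [h.z_zero] using h.z_le hm (sub_nonneg.mpr htt)) t ⟨ht, le_rfl⟩
  simpa using h1.1

theorem y_one_lt (hF : IsAdmissible F α) (hm : 0 ≤ m) (hζ : exp ζ < F α)
    (h : IsHalfOrbit m α F ζ y z) : y 1 < α := by
  refine lt_of_le_of_ne (h.le zero_le_one) fun heq => ?_
  have hconst : ∀ t ∈ Set.Icc (0 : ℝ) 1, y t = α := fun t ht =>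
    le_antisymm (h.le ht.1)
      (heq ▸ h.antitoneOn_y hF hm ht.1 (Set.mem_Ici.mpr (zero_le_one' ℝ)) ht.2)
  have h0 : (0 : ℝ) ∈ Set.Icc (0 : ℝ) 1 := ⟨le_rfl, zero_le_one⟩
  have h1 := (h.orbit 1).deriv_y 0 h0
  have h2 : HasDerivWithinAt y 0 (Set.Icc 0 1) 0 :=
    (hasDerivWithinAt_const 0 _ α).congr hconst (hconst 0 h0)
  have h3 := (uniqueDiffOn_Icc (zero_lt_one' ℝ) 0 h0).eq_deriv _ h1 h2
  rw [h.z_zero, h.y_zero] at h3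
  linarith

theorem z_le_linear (hF : IsAdmissible F α) (hm : 0 ≤ m) (h : IsHalfOrbit m α F ζ y z)
    {t : ℝ} (ht : 1 ≤ t) : z t ≤ ζ - m * (α - y 1) * (t - 1) := by
  have h01 : Set.Ici (1 : ℝ) ⊆ Set.Ici 0 := Set.Ici_subset_Ici.mpr zero_le_one
  have hanti : AntitoneOn (fun t => z t + m * (α - y 1) * t) (Set.Ici 1) :=
    antitoneOn_Ici_of_hasDerivWithinAt
      (fun t ht => ((h.hasDerivWithinAt_z (zero_le_one.trans ht)).mono h01).fun_add
        ((hasDerivAt_id t).const_mul _).hasDerivWithinAt)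
      fun t ht => by
        have := h.antitoneOn_y hF hm (Set.mem_Ici.mpr (zero_le_one' ℝ))
          (zero_le_one.trans ht) ht
        nlinarith [mul_le_mul_of_nonneg_left this hm]
  have h1 := hanti (Set.mem_Ici.mpr le_rfl) ht ht
  have h2 := h.z_le hm zero_le_one
  simp only at h1
  linarith

theorem tendsto_z (hF : IsAdmissible F α) (hm : 0 < m) (hζ : exp ζ < F α)
    (h : IsHalfOrbit m α F ζ y z) : Tendsto z atTop atBot := by
  have hε : 0 < m * (α - y 1) := mul_pos hm (sub_pos.mpr (h.y_one_lt hF hm.le hζ))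
  have h1 : Tendsto (fun t : ℝ => ζ - m * (α - y 1) * (t - 1)) atTop atBot := by
    have := (tendsto_atTop_add_const_right atTop (-1 : ℝ) tendsto_id).const_mul_atTop hε
    simpa [sub_eq_add_neg] using
      tendsto_atBot_add_const_left atTop ζ (tendsto_neg_atTop_atBot.comp this)
  refine tendsto_atBot_mono' _ ?_ h1
  filter_upwards [eventually_ge_atTop 1] with t ht using h.z_le_linear hF hm.le ht

/-- The accumulated mass `∫₀ᵗ y`, expressed through `z`. -/
theorem hasDerivWithinAt_mass (hm : 0 < m) (h : IsHalfOrbit m α F ζ y z) {t : ℝ} (ht : 0 ≤ t) :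
    HasDerivWithinAt (fun t => (z t - ζ) / m + α * t) (y t) (Set.Ici 0) t := by
  have := (((h.hasDerivWithinAt_z ht).sub_const ζ).div_const m).fun_add
    ((hasDerivAt_id t).const_mul α).hasDerivWithinAt
  have he : y t = -(m * (α - y t)) / m + α * 1 := by field_simp; ring
  rw [he]
  exact this

theorem continuousOn_z {zf yf : ℝ → ℝ → ℝ} (hF : IsAdmissible F α) (hm : 0 ≤ m) {ζs : ℝ}
    (h : ∀ ζ ≤ ζs, IsHalfOrbit m α F ζ (yf ζ) (zf ζ)) {T : ℝ} (hT : 0 ≤ T) :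
    ContinuousOn (fun ζ => zf ζ T) (Set.Iic ζs) := by
  intro ζ₀ hζ₀
  have hlow : ζ₀ - 1 ≤ ζs := by linarith [Set.mem_Iic.mp hζ₀]
  obtain ⟨δ, hδ, hδy⟩ := ((h (ζ₀ - 1) hlow).orbit T).exists_lower_bound hT
  obtain ⟨C, hC⟩ := IsOrbitOn.exists_dist_le (ζ := ζs) hF hm hδ T
  have hge : ∀ ζ, ζ₀ - 1 ≤ ζ → ζ ≤ ζs → ∀ t ∈ Set.Icc 0 T, δ ≤ yf ζ t := fun ζ h1 h2 t ht =>
    (hδy t ht).trans (mono hF hm (h _ hlow) (h _ h2) h1 ht.1).1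
  have key : ∀ᶠ ζ in 𝓝[Set.Iic ζs] ζ₀,
      |zf ζ T - zf ζ₀ T| ≤ |ζ - ζ₀| * exp (C * T / 2) := by
    filter_upwards [self_mem_nhdsWithin,
      mem_nhdsWithin_of_mem_nhds (Ici_mem_nhds (show ζ₀ - 1 < ζ₀ by linarith))] with ζ h1 h2
    have := hC _ _ _ _ ((h ζ h1).orbit T) ((h ζ₀ hζ₀).orbit T)
      (by rw [(h ζ h1).z_zero]; exact h1) (by rw [(h ζ₀ hζ₀).z_zero]; exact hζ₀)
      (hge ζ h2 h1) (hge ζ₀ (by linarith) hζ₀)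
      ((h ζ h1).y_zero.trans (h ζ₀ hζ₀).y_zero.symm) T ⟨hT, le_rfl⟩
    rw [(h ζ h1).z_zero, (h ζ₀ hζ₀).z_zero] at this
    refine abs_le_of_sq_le_sq' ?_ (by positivity) |> abs_le.mpr
    rw [mul_pow, sq_abs, ← exp_nat_mul]
    rwa [show ((2 : ℕ) : ℝ) * (C * T / 2) = C * T by push_cast; ring]
  rw [ContinuousWithinAt, tendsto_iff_dist_tendsto_zero]
  refine squeeze_zero' (Eventually.of_forall fun _ => dist_nonneg) key ?_
  have : Tendsto (fun ζ => |ζ - ζ₀| * exp (C * T / 2)) (𝓝 ζ₀) (𝓝 (|ζ₀ - ζ₀| * exp (C * T / 2))) :=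
    Continuous.tendsto (by fun_prop) ζ₀
  simpa using this.mono_left nhdsWithin_le_nhds

theorem isHalfOrbit_const (hα : 0 < α) (hζ : exp ζ = F α) :
    IsHalfOrbit m α F ζ (fun _ => α) fun _ => ζ :=
  ⟨rfl, rfl, fun T => ⟨fun t _ => by
    simpa [hζ] using hasDerivWithinAt_const t (Set.Icc 0 T) α, fun t _ => by
    simpa using hasDerivWithinAt_const t (Set.Icc 0 T) ζ, fun _ _ => hα, fun _ _ => le_rfl⟩⟩

end IsHalfOrbit

/-- The half-orbits issued from `(α, ζ)`, `ζ < ζs`, with the renormalised total mass `J ζ`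
depending monotonically and continuously on `ζ` and blowing up as `ζ → ζs`. -/
theorem exists_halfOrbit_family {m α ζs : ℝ} {F R : ℝ → ℝ} (hF : IsAdmissible F α) (hm : 0 < m)
    (hζs : exp ζs = F α)
    (hlim : ∀ ζ y z, ζ < ζs → IsHalfOrbit m α F ζ y z →
      ∃ L, Tendsto (fun t => (z t - ζ) / m + α * t - R t) atTop (𝓝 L)) :
    ∃ (y z : ℝ → ℝ → ℝ) (J : ℝ → ℝ),
      (∀ ζ < ζs, IsHalfOrbit m α F ζ (y ζ) (z ζ)) ∧
      (∀ ζ < ζs, Tendsto (fun t => (z ζ t - ζ) / m + α * t - R t) atTop (𝓝 (J ζ))) ∧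
      MonotoneOn J (Set.Iio ζs) ∧ ContinuousOn J (Set.Iio ζs) ∧
      Tendsto J (𝓝[<] ζs) atTop := by
  have hex : ∀ ζ : ℝ, ∃ y z, ζ ≤ ζs → IsHalfOrbit m α F ζ y z := fun ζ => by
    by_cases h : ζ ≤ ζs
    · obtain ⟨y, z, hyz⟩ := exists_isHalfOrbit hF hm.le (hζs ▸ exp_le_exp.mpr h)
      exact ⟨y, z, fun _ => hyz⟩
    · exact ⟨0, 0, fun h' => absurd h' h⟩
  choose y z ho using hex
  have hexJ : ∀ ζ : ℝ, ∃ L, ζ < ζs →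
      Tendsto (fun t => (z ζ t - ζ) / m + α * t - R t) atTop (𝓝 L) := fun ζ => by
    by_cases h : ζ < ζs
    · obtain ⟨L, hL⟩ := hlim ζ _ _ h (ho ζ h.le)
      exact ⟨L, fun _ => hL⟩
    · exact ⟨0, fun h' => absurd h' h⟩
  choose J hJ using hexJ
  set j : ℝ → ℝ → ℝ := fun t ζ => (z ζ t - ζ) / m + α * t - R t with hj
  have hincr : ∀ ζ₁ ζ₂, ζ₁ ≤ ζ₂ → ζ₂ < ζs → ∀ T, 0 ≤ T →
      J ζ₁ - j T ζ₁ ≤ J ζ₂ - j T ζ₂ := by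
    intro ζ₁ ζ₂ h12 h2 T hT
    refine le_of_tendsto_of_tendsto ((hJ ζ₁ (h12.trans_lt h2)).sub_const _)
      ((hJ ζ₂ h2).sub_const _) ?_
    filter_upwards [eventually_ge_atTop T] with t ht
    have := IsHalfOrbit.antitoneOn_sub hF hm.le (ho ζ₁ (h12.trans h2.le)) (ho ζ₂ h2.le) h12
      (Set.mem_Ici.mpr hT) (Set.mem_Ici.mpr (hT.trans ht)) ht
    have h3 := div_le_div_of_nonneg_right this hm.le
    simp only [hj]
    rw [sub_div, sub_div] at h3
    simp only [sub_div]
    linarith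
  have hj0 : ∀ ζ < ζs, j 0 ζ = -R 0 := fun ζ h => by
    simp [hj, (ho ζ h.le).z_zero]
  refine ⟨y, z, J, fun ζ h => ho ζ h.le, hJ, ?_, ?_, ?_⟩
  · intro ζ₁ h1 ζ₂ h2 h12
    have := hincr ζ₁ ζ₂ h12 h2 0 le_rfl
    rw [hj0 ζ₁ h1, hj0 ζ₂ h2] at this
    linarith
  · intro ζ₀ hζ₀
    obtain ⟨ζ₂, h02, h2s⟩ := exists_between (Set.mem_Iio.mp hζ₀)
    have hcont : ContinuousOn J (Set.Icc (ζ₀ - 1) ζ₂) := by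
      have hu : TendstoUniformlyOn j J atTop (Set.Icc (ζ₀ - 1) ζ₂) := by
        rw [Metric.tendstoUniformlyOn_iff]
        intro ε hε
        have e1 := (hJ ζ₂ h2s).eventually (Metric.ball_mem_nhds _ hε)
        have e2 := (hJ (ζ₀ - 1) (by linarith)).eventually (Metric.ball_mem_nhds _ hε)
        filter_upwards [e1, e2, eventually_ge_atTop 0] with T h1 h2 hT ζ hζ
        have i1 := hincr (ζ₀ - 1) ζ hζ.1 (hζ.2.trans_lt h2s) T hT
        have i2 := hincr ζ ζ₂ hζ.2 h2s T hT
        rw [dist_comm, Real.dist_eq, abs_lt] at h1 h2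
        rw [Real.dist_eq, abs_lt]
        exact ⟨lt_of_lt_of_le h2.1 i1, lt_of_le_of_lt i2 h1.2⟩
      refine hu.continuousOn ?_
      refine (Filter.Eventually.frequently ?_)
      filter_upwards [eventually_ge_atTop 0] with T hT
      have hz := (IsHalfOrbit.continuousOn_z hF hm.le ho hT).mono
        (show Set.Icc (ζ₀ - 1) ζ₂ ⊆ Set.Iic ζs from fun ζ h => h.2.trans h2s.le)
      simp only [hj]
      fun_prop
    exact (hcont.continuousAt (Icc_mem_nhds (by linarith) h02)).continuousWithinAt
  · set ζ₀ := ζs - 1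
    have hζ₀ : ζ₀ < ζs := by simp [ζ₀]
    have hexp₀ : exp ζ₀ < F α := hζs ▸ exp_lt_exp.mpr hζ₀
    rw [tendsto_atTop]
    intro M
    have hT : ∃ T, 0 ≤ T ∧ M < (ζ₀ - z ζ₀ T) / m + J ζ₀ := by
      have h1 := (ho ζ₀ hζ₀.le).tendsto_z hF hm hexp₀
      have h2 := h1.eventually (eventually_lt_atBot (ζ₀ - m * (M - J ζ₀)))
      obtain ⟨T, h3, h4⟩ := (h2.and (eventually_ge_atTop 0)).exists
      refine ⟨T, h4, ?_⟩
      have : M - J ζ₀ < (ζ₀ - z ζ₀ T) / m := by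
        rw [lt_div_iff₀ hm]; linarith
      linarith
    obtain ⟨T, hT0, hTM⟩ := hT
    have hzs : z ζs T = ζs := by
      have hc := IsHalfOrbit.isHalfOrbit_const (m := m) hF.pos hζs
      exact le_antisymm (IsHalfOrbit.mono hF hm.le (ho ζs le_rfl) hc le_rfl hT0).2
        (IsHalfOrbit.mono hF hm.le hc (ho ζs le_rfl) le_rfl hT0).2
    have hcz := IsHalfOrbit.continuousOn_z hF hm.le ho hT0 ζs (Set.mem_Iic.mpr le_rfl)
    have hcz' : Tendsto (fun ζ => (z ζ T - ζ) / m + (ζ₀ - z ζ₀ T) / m + J ζ₀) (𝓝[<] ζs)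
        (𝓝 ((z ζs T - ζs) / m + (ζ₀ - z ζ₀ T) / m + J ζ₀)) :=
      (((Tendsto.sub (hcz.mono_left (nhdsWithin_mono _ Set.Iio_subset_Iic_self))
        (tendsto_id.mono_left nhdsWithin_le_nhds)).div_const m).add_const _).add_const _
    rw [hzs, sub_self, zero_div, zero_add] at hcz'
    filter_upwards [hcz'.eventually (lt_mem_nhds hTM), self_mem_nhdsWithin,
      mem_nhdsWithin_of_mem_nhds (lt_mem_nhds hζ₀)] with ζ h1 h2 h3
    have := hincr ζ₀ ζ h3.le h2 T hT0
    simp only [hj] at this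
    simp only [sub_div] at this h1
    linarith

theorem exists_tendsto_of_monotoneOn_Ici {f : ℝ → ℝ} {a B : ℝ} (h : MonotoneOn f (Set.Ici a))
    (hB : ∀ t, a ≤ t → f t ≤ B) : ∃ L, Tendsto f atTop (𝓝 L) := by
  have hm : Monotone fun t => f (max t a) := fun s t hst =>
    h (Set.mem_Ici.mpr (le_max_right _ _)) (Set.mem_Ici.mpr (le_max_right _ _)) (max_le_max_right a hst)
  have hb : BddAbove (Set.range fun t => f (max t a)) :=
    ⟨B, by rintro _ ⟨t, rfl⟩; exact hB _ (le_max_right _ _)⟩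
  refine ⟨_, (tendsto_atTop_ciSup hm hb).congr' ?_⟩
  filter_upwards [eventually_ge_atTop a] with t ht
  rw [max_eq_left ht]

theorem monotoneOn_Ici_of_hasDerivWithinAt {f f' : ℝ → ℝ} {a : ℝ}
    (h : ∀ t, a ≤ t → HasDerivWithinAt f (f' t) (Set.Ici a) t) (hle : ∀ t, a ≤ t → 0 ≤ f' t) :
    MonotoneOn f (Set.Ici a) :=
  monotoneOn_of_hasDerivWithinAt_nonneg (convex_Ici a) (fun t ht => (h t ht).continuousWithinAt)
    (fun t ht => (h t (interior_subset ht)).mono interior_subset)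
    fun t ht => hle t (interior_subset ht)

theorem hasDerivWithinAt_const_div {t : ℝ} (ht : t ≠ 0) (H : ℝ) (s : Set ℝ) :
    HasDerivWithinAt (fun t => H / t) (-(H / t ^ 2)) s t := by
  have := ((hasDerivAt_inv ht).const_mul H).hasDerivWithinAt (s := s)
  simpa [div_eq_mul_inv] using! this

theorem exists_tendsto_of_abs_deriv_le_div_sq {f f' : ℝ → ℝ} {a H : ℝ} (ha : 0 < a)
    (hH : 0 ≤ H) (h : ∀ t, a ≤ t → HasDerivWithinAt f (f' t) (Set.Ici a) t)
    (hle : ∀ t, a ≤ t → |f' t| ≤ H / t ^ 2) : ∃ L, Tendsto f atTop (𝓝 L) := by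
  have h1 : MonotoneOn (fun t => f t - H / t) (Set.Ici a) :=
    monotoneOn_Ici_of_hasDerivWithinAt
      (fun t ht => (h t ht).fun_sub (hasDerivWithinAt_const_div (ha.trans_le ht).ne' H _))
      fun t ht => by linarith [neg_le_of_abs_le (hle t ht)]
  have h2 : AntitoneOn (fun t => f t + H / t) (Set.Ici a) :=
    antitoneOn_Ici_of_hasDerivWithinAt
      (fun t ht => (h t ht).fun_add (hasDerivWithinAt_const_div (ha.trans_le ht).ne' H _))
      fun t ht => by linarith [le_of_abs_le (hle t ht)]
  obtain ⟨L, hL⟩ := exists_tendsto_of_monotoneOn_Ici (B := f a + H / a) h1 fun t ht => by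
    have e1 := h2 (Set.mem_Ici.mpr le_rfl) ht ht
    have e2 : 0 ≤ H / t := div_nonneg hH (ha.le.trans ht)
    simp only at e1
    linarith
  refine ⟨L + 0, ?_⟩
  have h3 : Tendsto (fun t : ℝ => H / t) atTop (𝓝 0) := tendsto_const_nhds.div_atTop tendsto_id
  exact (hL.add h3).congr fun t => by ring

namespace IsHalfOrbit

variable {m α ζ : ℝ} {F y z : ℝ → ℝ}

theorem exists_tendsto_mass_of_linear (hF : IsAdmissible F α) (hm : 0 < m) (hζ : exp ζ < F α)
    {k₀ : ℝ} (hk₀ : 0 < k₀) (hk : ∀ x, 0 < x → x ≤ α → k₀ * x ≤ F x)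
    (h : IsHalfOrbit m α F ζ y z) :
    ∃ L, Tendsto (fun t => (z t - ζ) / m + α * t) atTop (𝓝 L) := by
  have hε : 0 < α - y 1 := sub_pos.mpr (h.y_one_lt hF hm.le hζ)
  have h01 : Set.Ici (1 : ℝ) ⊆ Set.Ici 0 := Set.Ici_subset_Ici.mpr zero_le_one
  have hmono : MonotoneOn (fun t => (z t - ζ) / m + α * t) (Set.Ici 1) :=
    monotoneOn_Ici_of_hasDerivWithinAt
      (fun t ht => (h.hasDerivWithinAt_mass hm (zero_le_one.trans ht)).mono h01)
      fun t ht => (h.pos (zero_le_one.trans ht)).le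
  have hanti : AntitoneOn (fun t => y t + k₀ * ((z t - ζ) / m + α * t)
      + exp (z t) / (m * (α - y 1))) (Set.Ici 1) :=
    antitoneOn_Ici_of_hasDerivWithinAt
      (fun t ht => (((h.hasDerivWithinAt_y (zero_le_one.trans ht)).fun_add
        ((h.hasDerivWithinAt_mass hm (zero_le_one.trans ht)).const_mul k₀)).fun_add
        ((h.hasDerivWithinAt_z (zero_le_one.trans ht)).exp.div_const _)).mono h01)
      fun t ht => by
        have h0 : 0 ≤ t := zero_le_one.trans ht
        have e1 := hk (y t) (h.pos h0) (h.le h0)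
        have e2 : y t ≤ y 1 := h.antitoneOn_y hF hm.le (Set.mem_Ici.mpr (zero_le_one' ℝ)) h0 ht
        have e3 : exp (z t) * -(m * (α - y t)) / (m * (α - y 1)) ≤ -exp (z t) := by
          rw [div_le_iff₀ (mul_pos hm hε)]
          have := mul_le_mul_of_nonneg_left (mul_le_mul_of_nonneg_left e2 hm.le) (exp_pos (z t)).le
          nlinarith
        linarith
  refine exists_tendsto_of_monotoneOn_Ici (B := (y 1 + k₀ * ((z 1 - ζ) / m + α * 1)
      + exp (z 1) / (m * (α - y 1))) / k₀) hmono fun t ht => ?_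
  rw [le_div_iff₀ hk₀]
  have e1 := hanti (Set.mem_Ici.mpr le_rfl) ht ht
  have e2 := h.pos (zero_le_one.trans ht)
  have e3 : 0 < exp (z t) / (m * (α - y 1)) := div_pos (exp_pos _) (mul_pos hm hε)
  simp only at e1
  linarith

/-- Decay estimates for a half-orbit when `F` vanishes quadratically at `0`. -/
theorem exists_bounds_of_quadratic (hF : IsAdmissible F α) (hm : 0 < m) (hζ : exp ζ < F α)
    {k₀ C' : ℝ} (hk₀ : 0 < k₀) (hk : ∀ x, 0 < x → x ≤ α → k₀ * x ^ 2 ≤ F x)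
    (hC' : ∀ x, 0 < x → x ≤ α → F x ≤ C' * x ^ 2) (h : IsHalfOrbit m α F ζ y z) :
    ∃ D M t₁, 0 < D ∧ 0 < M ∧ 1 ≤ t₁ ∧ ∀ t, t₁ ≤ t →
      exp (z t) / y t ^ 2 ≤ D / t ^ 2 ∧ y t ≤ M / t := by
  have hα := hF.pos
  set μ := m * (α - y 1) with hμdef
  have hμ : 0 < μ := mul_pos hm (sub_pos.mpr (h.y_one_lt hF hm.le hζ))
  have h01 : Set.Ici (1 : ℝ) ⊆ Set.Ici 0 := Set.Ici_subset_Ici.mpr zero_le_one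
  have hC'0 : 0 < C' := by
    have := (hk α hα le_rfl).trans (hC' α hα le_rfl)
    have h2 : 0 < k₀ * α ^ 2 := by positivity
    exact pos_of_mul_pos_left (h2.trans_le this) (by positivity)
  have hx : ∀ t, 1 ≤ t → HasDerivWithinAt (fun t => (y t)⁻¹)
      (-(exp (z t) - F (y t)) / y t ^ 2) (Set.Ici 1) t := fun t ht =>
    ((h.hasDerivWithinAt_y (zero_le_one.trans ht)).mono h01).fun_inv
      (h.pos (zero_le_one.trans ht)).ne'
  have hx1 : 0 < (y 1)⁻¹ := inv_pos.mpr (h.pos zero_le_one)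
  have hxle : ∀ t, 1 ≤ t → (y t)⁻¹ ≤ ((y 1)⁻¹ + C') * t := by
    intro t ht
    have hanti : AntitoneOn (fun t => (y t)⁻¹ - C' * t) (Set.Ici 1) :=
      antitoneOn_Ici_of_hasDerivWithinAt
        (fun t ht => (hx t ht).fun_sub ((hasDerivAt_id t).const_mul C').hasDerivWithinAt)
        fun t ht => by
          have h0 := zero_le_one.trans ht
          have hy := h.pos h0
          have : -(exp (z t) - F (y t)) / y t ^ 2 ≤ C' := by
            rw [div_le_iff₀ (by positivity)]
            linarith [hC' (y t) hy (h.le h0), exp_pos (z t)]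
          linarith
    have := hanti (Set.mem_Ici.mpr le_rfl) ht ht
    simp only at this
    nlinarith
  set B := (y 1)⁻¹ + C'
  have hB : 0 < B := by positivity
  set D := exp (ζ + μ) * B ^ 2 * (24 / μ ^ 4) with hD
  have hDpos : 0 < D := by positivity
  have hW : ∀ t, 1 ≤ t → exp (z t) / y t ^ 2 ≤ D / t ^ 2 := by
    intro t ht
    have h0 : 0 < t := zero_lt_one.trans_le ht
    have hy := h.pos h0.le
    have e1 : exp (z t) ≤ exp (ζ + μ) * exp (-(μ * t)) := by
      rw [← exp_add]
      exact exp_le_exp.mpr ((h.z_le_linear hF hm.le ht).trans_eq (by ring))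
    have e2 : exp (-(μ * t)) ≤ 24 / (μ * t) ^ 4 := by
      have := pow_div_factorial_le_exp (μ * t) (by positivity) 4
      rw [exp_neg, inv_le_comm₀ (exp_pos _) (by positivity), inv_div]
      simpa [Nat.factorial] using this
    have e3 : ((y t)⁻¹) ^ 2 ≤ (B * t) ^ 2 :=
      pow_le_pow_left₀ (inv_pos.mpr hy).le (hxle t ht) 2
    calc exp (z t) / y t ^ 2 = exp (z t) * ((y t)⁻¹) ^ 2 := by rw [inv_pow]; rfl
      _ ≤ (exp (ζ + μ) * (24 / (μ * t) ^ 4)) * (B * t) ^ 2 := by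
          refine mul_le_mul (e1.trans ?_) e3 (by positivity) (by positivity)
          exact mul_le_mul_of_nonneg_left e2 (exp_pos _).le
      _ = D / t ^ 2 := by rw [hD]; field_simp
  have hxge : ∀ t, 1 ≤ t → k₀ * t - (k₀ + D) ≤ (y t)⁻¹ := by
    intro t ht
    have hmono : MonotoneOn (fun t => (y t)⁻¹ - k₀ * t - D / t) (Set.Ici 1) :=
      monotoneOn_Ici_of_hasDerivWithinAt
        (fun t ht => ((hx t ht).fun_sub ((hasDerivAt_id t).const_mul k₀).hasDerivWithinAt).fun_sub
          (hasDerivWithinAt_const_div (zero_lt_one.trans_le ht).ne' D _))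
        fun t ht => by
          have h0 := zero_le_one.trans ht
          have hy := h.pos h0
          have e1 : k₀ ≤ F (y t) / y t ^ 2 := by
            rw [le_div_iff₀ (by positivity)]; exact hk _ hy (h.le h0)
          have e2 := hW t ht
          rw [neg_sub, sub_div]
          linarith
    have := hmono (Set.mem_Ici.mpr le_rfl) ht ht
    have h3 : 0 < D / t := div_pos hDpos (zero_lt_one.trans_le ht)
    simp only [div_one] at this
    linarith
  have h1q : 0 ≤ 2 * (k₀ + D) / k₀ := by positivity
  refine ⟨D, 2 / k₀, 2 * (k₀ + D) / k₀ + 1, hDpos, by positivity, by linarith, fun t ht => ?_⟩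
  have ht1 : 1 ≤ t := by linarith
  have h0 : 0 < t := by linarith
  refine ⟨hW t ht1, ?_⟩
  have hy := h.pos h0.le
  have e1 : k₀ + D ≤ k₀ / 2 * t := by
    have : 2 * (k₀ + D) / k₀ ≤ t := by linarith
    rw [div_le_iff₀ hk₀] at this
    linarith
  have e2 : k₀ / 2 * t ≤ (y t)⁻¹ := by linarith [hxge t ht1]
  rw [le_inv_comm₀ (by positivity) hy] at e2
  refine e2.trans_eq ?_
  field_simp

theorem exists_tendsto_mass_of_quadratic (hF : IsAdmissible F α) (hm : 0 < m)
    (hζ : exp ζ < F α) {k₀ k C : ℝ} (hk₀ : 0 < k₀) (hkpos : 0 < k) (hC : 0 ≤ C)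
    (hk : ∀ x, 0 < x → x ≤ α → k₀ * x ^ 2 ≤ F x)
    (hk2 : ∀ x, 0 < x → x ≤ α → |F x - k * x ^ 2| ≤ C * x ^ 3)
    (h : IsHalfOrbit m α F ζ y z) :
    ∃ L, Tendsto (fun t => (z t - ζ) / m + α * t - 1 / k * log t) atTop (𝓝 L) := by
  have hα := hF.pos
  obtain ⟨D, M, t₁, hD, hM, ht₁, hbd⟩ := h.exists_bounds_of_quadratic hF hm hζ hk₀ hk
    (C' := k + C * α) fun x hx hxα => by
      have e1 := le_of_abs_le (hk2 x hx hxα)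
      have e2 : C * x ^ 3 ≤ C * α * x ^ 2 := by
        rw [pow_succ', ← mul_assoc]
        exact mul_le_mul_of_nonneg_right (mul_le_mul_of_nonneg_left hxα hC) (by positivity)
      linarith
  have ht₁0 : 0 < t₁ := zero_lt_one.trans_le ht₁
  have h01 : Set.Ici t₁ ⊆ Set.Ici 0 := Set.Ici_subset_Ici.mpr ht₁0.le
  have hx : ∀ t, t₁ ≤ t → HasDerivWithinAt (fun t => (y t)⁻¹)
      (-(exp (z t) - F (y t)) / y t ^ 2) (Set.Ici t₁) t := fun t ht =>
    ((h.hasDerivWithinAt_y (ht₁0.le.trans ht)).mono h01).fun_inv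
      (h.pos (ht₁0.le.trans ht)).ne'
  have hFk : ∀ t, t₁ ≤ t → |F (y t) / y t ^ 2 - k| ≤ C * y t := fun t ht => by
    have h0 := ht₁0.le.trans ht
    have hy := h.pos h0
    have e : F (y t) / y t ^ 2 - k = (F (y t) - k * y t ^ 2) / y t ^ 2 := by field_simp
    rw [e, abs_div, abs_of_pos (show 0 < y t ^ 2 by positivity), div_le_iff₀ (by positivity)]
    exact (hk2 _ hy (h.le h0)).trans_eq (by ring)
  obtain ⟨L, hL⟩ : ∃ L, Tendsto (fun t => (z t - ζ) / m + α * t - 1 / k * log (y t)⁻¹)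
      atTop (𝓝 L) := by
    refine exists_tendsto_of_abs_deriv_le_div_sq (H := (C * M ^ 2 + D * α) / k) ht₁0
      (by positivity) (fun t ht => ((h.hasDerivWithinAt_mass hm (ht₁0.le.trans ht)).mono h01).fun_sub
        (((hx t ht).log (inv_pos.mpr (h.pos (ht₁0.le.trans ht))).ne').const_mul (1 / k)))
      fun t ht => ?_
    have h0 : 0 < t := ht₁0.trans_le ht
    have hy := h.pos h0.le
    obtain ⟨b1, b2⟩ := hbd t ht
    have e : y t - 1 / k * (-(exp (z t) - F (y t)) / y t ^ 2 / (y t)⁻¹)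
        = (-(y t * (F (y t) / y t ^ 2 - k)) + y t * (exp (z t) / y t ^ 2)) / k := by
      field_simp
      ring
    rw [e, abs_div, abs_of_pos hkpos, div_div, mul_comm k, ← div_div]
    refine div_le_div_of_nonneg_right ?_ hkpos.le
    refine (abs_add_le _ _).trans ?_
    rw [abs_neg, abs_mul, abs_of_pos hy, abs_of_pos (show 0 < y t * (exp (z t) / y t ^ 2) by
      have := exp_pos (z t); positivity), add_div]
    refine add_le_add ?_ ?_
    · calc y t * |F (y t) / y t ^ 2 - k| ≤ y t * (C * y t) :=
            mul_le_mul_of_nonneg_left (hFk t ht) hy.le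
        _ = C * y t ^ 2 := by ring
        _ ≤ C * (M / t) ^ 2 := mul_le_mul_of_nonneg_left (pow_le_pow_left₀ hy.le b2 2) hC
        _ = C * M ^ 2 / t ^ 2 := by rw [div_pow]; ring
    · calc y t * (exp (z t) / y t ^ 2) ≤ α * (D / t ^ 2) :=
            mul_le_mul (h.le h0.le) b1 (by have := exp_pos (z t); positivity) hα.le
        _ = D * α / t ^ 2 := by ring
  have hxt : Tendsto (fun t => (y t)⁻¹ / t) atTop (𝓝 k) := by
    set E := C * M + D
    have hE : 0 ≤ E := by positivity
    have hder : ∀ t, t₁ ≤ t → |-(exp (z t) - F (y t)) / y t ^ 2 - k| ≤ E * t⁻¹ := by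
      intro t ht
      have h0 : 0 < t := ht₁0.trans_le ht
      have hy := h.pos h0.le
      obtain ⟨b1, b2⟩ := hbd t ht
      have e : -(exp (z t) - F (y t)) / y t ^ 2 - k
          = (F (y t) / y t ^ 2 - k) + -(exp (z t) / y t ^ 2) := by ring
      rw [e]
      refine (abs_add_le _ _).trans ?_
      rw [abs_neg, abs_of_pos (show 0 < exp (z t) / y t ^ 2 by
        have := exp_pos (z t); positivity), add_mul]
      refine add_le_add ((hFk t ht).trans ?_) (b1.trans ?_)
      · rw [mul_assoc]; exact mul_le_mul_of_nonneg_left b2 hC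
      · rw [div_eq_mul_inv]
        refine mul_le_mul_of_nonneg_left (inv_anti₀ h0 ?_) hD.le
        nlinarith [ht₁.trans ht]
    have hanti : AntitoneOn (fun t => (y t)⁻¹ - k * t - E * log t) (Set.Ici t₁) :=
      antitoneOn_Ici_of_hasDerivWithinAt
        (fun t ht => ((hx t ht).fun_sub ((hasDerivAt_id t).const_mul k).hasDerivWithinAt).fun_sub
          ((hasDerivAt_log (ht₁0.trans_le ht).ne').const_mul E).hasDerivWithinAt)
        fun t ht => by linarith [le_of_abs_le (hder t ht)]
    have hmono : MonotoneOn (fun t => (y t)⁻¹ - k * t + E * log t) (Set.Ici t₁) :=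
      monotoneOn_Ici_of_hasDerivWithinAt
        (fun t ht => ((hx t ht).fun_sub ((hasDerivAt_id t).const_mul k).hasDerivWithinAt).fun_add
          ((hasDerivAt_log (ht₁0.trans_le ht).ne').const_mul E).hasDerivWithinAt)
        fun t ht => by linarith [neg_le_of_abs_le (hder t ht)]
    have hlog : Tendsto (fun t : ℝ => log t / t) atTop (𝓝 0) := by
      simpa using isLittleO_log_id_atTop.tendsto_div_nhds_zero
    have hlim : ∀ G e : ℝ, Tendsto (fun t => k + G / t + e * (log t / t)) atTop (𝓝 k) :=
      fun G e => by
        simpa using (tendsto_const_nhds (x := k)).add (tendsto_const_nhds.div_atTop tendsto_id)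
          |>.add (hlog.const_mul e) (f := fun t => k + G / t)
    refine tendsto_of_tendsto_of_tendsto_of_le_of_le'
      (hlim ((y t₁)⁻¹ - k * t₁ + E * log t₁) (-E)) (hlim ((y t₁)⁻¹ - k * t₁ - E * log t₁) E) ?_ ?_
    · filter_upwards [eventually_ge_atTop t₁] with t ht
      have h0 : 0 < t := ht₁0.trans_le ht
      have := hmono (Set.mem_Ici.mpr le_rfl) ht ht
      simp only at this
      rw [le_div_iff₀ h0, add_mul, add_mul, div_mul_cancel₀ _ h0.ne', mul_assoc,
        div_mul_cancel₀ _ h0.ne']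
      linarith
    · filter_upwards [eventually_ge_atTop t₁] with t ht
      have h0 : 0 < t := ht₁0.trans_le ht
      have := hanti (Set.mem_Ici.mpr le_rfl) ht ht
      simp only at this
      rw [div_le_iff₀ h0, add_mul, add_mul, div_mul_cancel₀ _ h0.ne', mul_assoc,
        div_mul_cancel₀ _ h0.ne']
      linarith
  refine ⟨L + 1 / k * log k, ?_⟩
  refine (hL.add ((hxt.log hkpos.ne').const_mul (1 / k))).congr' ?_
  filter_upwards [eventually_ge_atTop t₁] with t ht
  have h0 : 0 < t := ht₁0.trans_le ht
  rw [log_div (inv_pos.mpr (h.pos h0.le)).ne' h0.ne']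
  ring

end IsHalfOrbit

theorem exists_pos_le_of_continuousOn_Ioc {G : ℝ → ℝ} {α c : ℝ} (hα : 0 < α) (hc : 0 < c)
    (hG : ContinuousOn G (Set.Ioc 0 α)) (hpos : ∀ x, 0 < x → x ≤ α → 0 < G x)
    (hev : ∀ᶠ x in 𝓝[>] 0, c ≤ G x) : ∃ k, 0 < k ∧ ∀ x, 0 < x → x ≤ α → k ≤ G x := by
  obtain ⟨δ, hδ, hδG⟩ := mem_nhdsGT_iff_exists_Ioo_subset.mp hev
  have hδ0 : 0 < min δ α := lt_min hδ hα
  obtain ⟨s, hs, hmin⟩ := (isCompact_Icc (a := min δ α) (b := α)).exists_isMinOn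
    ⟨α, min_le_right _ _, le_rfl⟩ (hG.mono fun x hx => ⟨hδ0.trans_le hx.1, hx.2⟩)
  refine ⟨min c (G s), lt_min hc (hpos s (hδ0.trans_le hs.1) hs.2), fun x hx hxα => ?_⟩
  rcases lt_or_ge x δ with h | h
  · exact (min_le_left _ _).trans (hδG ⟨hx, h⟩)
  · exact (min_le_right _ _).trans (hmin ⟨(min_le_left _ _).trans h, hxα⟩)

theorem abs_le_mul_pow_succ_of_hasDerivAt {H H' : ℝ → ℝ} {α C : ℝ} {n : ℕ} (hC : 0 ≤ C)
    (hd : ∀ x ∈ Set.Icc 0 α, HasDerivAt H (H' x) x) (h0 : H 0 = 0)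
    (hb : ∀ x ∈ Set.Icc 0 α, |H' x| ≤ C * x ^ n) :
    ∀ x ∈ Set.Icc 0 α, |H x| ≤ C * x ^ (n + 1) := by
  intro x hx
  have hsub : Set.Icc 0 x ⊆ Set.Icc 0 α := Set.Icc_subset_Icc_right hx.2
  have := (convex_Icc 0 x).norm_image_sub_le_of_norm_hasDerivWithin_le (C := C * x ^ n)
    (fun s hs => (hd s (hsub hs)).hasDerivWithinAt)
    (fun s hs => (hb s (hsub hs)).trans
      (mul_le_mul_of_nonneg_left (pow_le_pow_left₀ hs.1 hs.2 n) hC))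
    (Set.left_mem_Icc.mpr hx.1) (Set.right_mem_Icc.mpr hx.1)
  rw [h0, sub_zero, sub_zero, Real.norm_eq_abs, Real.norm_eq_abs, abs_of_nonneg hx.1] at this
  rwa [pow_succ, ← mul_assoc]

/-- The nonlinearity `p ↦ f_ρ(-p)`, for `p > 0`. -/
def slopeFun (ρ lam τ p : ℝ) : ℝ := p ^ 2 - 2 * ρ * p + lam * p ^ (1 - τ)

section SlopeFun

variable {ρ lam τ : ℝ}

theorem fRho_neg {p : ℝ} (hp : 0 < p) : fRho ρ lam τ (-p) = slopeFun ρ lam τ p := by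
  rw [fRho, slopeFun, abs_neg, abs_of_pos hp]; ring

theorem slopeFun_eq_mul {p : ℝ} (hp : 0 < p) :
    slopeFun ρ lam τ p = p * (p - 2 * ρ + lam * p ^ (-τ)) := by
  rw [slopeFun, sub_eq_add_neg (1 : ℝ) τ, rpow_add hp, rpow_one]; ring

theorem continuous_slopeFun (hτ1 : τ < 1) : Continuous (slopeFun ρ lam τ) := by
  unfold slopeFun
  have := continuous_id.rpow_const (p := 1 - τ) fun x : ℝ => Or.inr (by linarith)
  simp only [id] at this
  fun_prop

theorem slopeFun_zero (hτ1 : τ < 1) : slopeFun ρ lam τ 0 = 0 := by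
  simp [slopeFun, zero_rpow (by linarith : (1 : ℝ) - τ ≠ 0)]

theorem hasDerivAt_slopeFun {p : ℝ} (hp : 0 < p) :
    HasDerivAt (slopeFun ρ lam τ) (2 * p - 2 * ρ + lam * ((1 - τ) * p ^ (-τ))) p := by
  have h := (((hasDerivAt_pow 2 p).sub ((hasDerivAt_id p).const_mul (2 * ρ))).add
    ((hasDerivAt_rpow_const (p := 1 - τ) (Or.inl hp.ne')).const_mul lam))
  have e : (2 : ℝ) * p - 2 * ρ + lam * ((1 - τ) * p ^ (-τ)) =
      ((2 : ℕ) : ℝ) * p ^ (2 - 1) - 2 * ρ * 1 + lam * ((1 - τ) * p ^ (1 - τ - 1)) := by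
    rw [show 1 - τ - 1 = -τ by ring]; push_cast; ring
  rw [e]
  exact h

theorem tendsto_slopeFun_div (hlam : 0 < lam) (hτ0 : 0 < τ) :
    Tendsto (fun p => slopeFun ρ lam τ p / p) (𝓝[>] 0) atTop := by
  have h1 : Tendsto (fun p : ℝ => p - 2 * ρ) (𝓝[>] 0) (𝓝 (0 - 2 * ρ)) :=
    (Continuous.tendsto (by fun_prop) 0).mono_left nhdsWithin_le_nhds
  have h2 := h1.add_atTop ((tendsto_rpow_neg_nhdsGT_zero (neg_neg_of_pos hτ0)).const_mul_atTop hlam)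
  refine h2.congr' ?_
  filter_upwards [self_mem_nhdsWithin] with p hp
  rw [slopeFun_eq_mul hp, mul_div_cancel_left₀ _ (ne_of_gt hp)]

theorem exists_lipschitz_slopeFun {δ : ℝ} (hδ : 0 < δ) (c : ℝ) :
    ∃ K, 0 ≤ K ∧ ∀ x ∈ Set.Icc δ c, ∀ y ∈ Set.Icc δ c,
      |slopeFun ρ lam τ x - slopeFun ρ lam τ y| ≤ K * |x - y| := by
  have hc : ContinuousOn (fun p : ℝ => 2 * p - 2 * ρ + lam * ((1 - τ) * p ^ (-τ)))
      (Set.Icc δ c) := by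
    have := (continuousOn_id (s := Set.Icc δ c)).rpow_const (p := -τ)
      fun x hx => Or.inl (hδ.trans_le hx.1).ne'
    simp only [id] at this
    fun_prop
  obtain ⟨K, hK⟩ := isCompact_Icc.exists_bound_of_continuousOn hc
  refine ⟨max K 0, le_max_right _ _, fun x hx y hy => ?_⟩
  exact (convex_Icc δ c).norm_image_sub_le_of_norm_hasDerivWithin_le
    (fun p hp => (hasDerivAt_slopeFun (hδ.trans_le hp.1)).hasDerivWithinAt)
    (fun p hp => (hK p hp).trans (le_max_left _ _)) hy hx

theorem isAdmissible_slopeFun (hτ1 : τ < 1) {a : ℝ} (ha : 0 < a) :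
    IsAdmissible (slopeFun ρ lam τ) a where
  pos := ha
  lipschitz := fun _ hδ => exists_lipschitz_slopeFun hδ a
  tendsto := by
    have := (continuous_slopeFun (ρ := ρ) (lam := lam) hτ1).tendsto 0
    rw [slopeFun_zero hτ1] at this
    exact this.mono_left nhdsWithin_le_nhds

theorem isAdmissible_slopeFun_reflect (hτ1 : τ < 1) {a P : ℝ} (ha : 0 < a) (haP : a < P)
    (hP : slopeFun ρ lam τ P = 0) :
    IsAdmissible (fun y => slopeFun ρ lam τ (P - y)) (P - a) where
  pos := sub_pos.mpr haP
  lipschitz := fun δ hδ => by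
    obtain ⟨K, hK, h⟩ := exists_lipschitz_slopeFun (ρ := ρ) (lam := lam) (τ := τ) ha P
    refine ⟨K, hK, fun x hx y hy => ?_⟩
    have := h (P - x) ⟨by linarith [hx.2], by linarith [hx.1]⟩ (P - y)
      ⟨by linarith [hy.2], by linarith [hy.1]⟩
    rwa [show P - x - (P - y) = -(x - y) by ring, abs_neg] at this
  tendsto := by
    have hc : Continuous fun y => slopeFun ρ lam τ (P - y) :=
      (continuous_slopeFun hτ1).comp (by fun_prop)
    have := hc.tendsto 0
    simp only [sub_zero, hP] at this
    exact this.mono_left nhdsWithin_le_nhds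

/-- `slopeFun` is positive below its smallest positive zero. -/
theorem slopeFun_pos (hlam : 0 < lam) (hτ0 : 0 < τ) (hτ1 : τ < 1) {P : ℝ}
    (hmin : ∀ p, 0 < p → slopeFun ρ lam τ p = 0 → P ≤ p) {p : ℝ} (hp : 0 < p) (hpP : p < P) :
    0 < slopeFun ρ lam τ p := by
  by_contra! hle
  obtain ⟨s, hs1, hs2, hsp⟩ : ∃ s, 0 < slopeFun ρ lam τ s / s ∧ 0 < s ∧ s < p := by
    have h1 := (tendsto_slopeFun_div (ρ := ρ) hlam hτ0).eventually (eventually_gt_atTop 0)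
    obtain ⟨s, h2, h3⟩ := (h1.and (Ioo_mem_nhdsGT hp)).exists
    exact ⟨s, h2, h3⟩
  have hs : 0 < slopeFun ρ lam τ s := by
    rw [← div_mul_cancel₀ (slopeFun ρ lam τ s) hs2.ne']; positivity
  obtain ⟨r, hr, hr0⟩ := intermediate_value_Icc' hsp.le
    (continuous_slopeFun (ρ := ρ) (lam := lam) hτ1).continuousOn ⟨hle, hs.le⟩
  exact absurd (hmin r (hs2.trans_le hr.1) hr0) (not_le.mpr (hr.2.trans_lt hpP))

theorem rpow_one_div_rpow_add_one (hlam : 0 < lam) (hτ0 : 0 < τ) :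
    ((lam * τ) ^ (1 / (τ + 1))) ^ (τ + 1) = lam * τ := by
  rw [← rpow_mul (by positivity), one_div_mul_cancel (by positivity), rpow_one]

theorem lam_mul_rpow_neg {p : ℝ} (hp : 0 < p) (h : p ^ (τ + 1) = lam * τ) (hτ0 : 0 < τ) :
    lam * p ^ (-τ) = p / τ := by
  have h1 : p ^ (-τ) * p ^ (τ + 1) = p := by rw [← rpow_add hp]; simp
  rw [h] at h1
  rw [eq_div_iff hτ0.ne']
  linarith

theorem slopeFun_critical (hlam : 0 < lam) (hτ0 : 0 < τ) :
    slopeFun ρ lam τ ((lam * τ) ^ (1 / (τ + 1)))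
      = (lam * τ) ^ (1 / (τ + 1)) * (2 * (Upsilon lam τ - ρ)) := by
  have hp : 0 < (lam * τ) ^ (1 / (τ + 1)) := rpow_pos_of_pos (by positivity) _
  rw [slopeFun_eq_mul hp, lam_mul_rpow_neg hp (rpow_one_div_rpow_add_one hlam hτ0) hτ0, Upsilon]
  field_simp
  ring

theorem rpow_root_lt (hlam : 0 < lam) (hτ0 : 0 < τ) (hτ1 : τ < 1) (hρ : Upsilon lam τ < ρ)
    {P : ℝ} (hP0 : 0 < P) (hP : slopeFun ρ lam τ P = 0)
    (hmin : ∀ p, 0 < p → slopeFun ρ lam τ p = 0 → P ≤ p) : P ^ (τ + 1) < lam * τ := by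
  rw [← rpow_one_div_rpow_add_one hlam hτ0]
  have hp : 0 < (lam * τ) ^ (1 / (τ + 1)) := rpow_pos_of_pos (by positivity) _
  have hneg : slopeFun ρ lam τ ((lam * τ) ^ (1 / (τ + 1))) < 0 := by
    rw [slopeFun_critical hlam hτ0]
    exact mul_neg_of_pos_of_neg hp (by linarith)
  refine rpow_lt_rpow hP0.le (lt_of_not_ge fun hle => ?_) (by positivity)
  rcases hle.lt_or_eq with h | h
  · exact absurd (slopeFun_pos hlam hτ0 hτ1 hmin hp h) (not_lt.mpr hneg.le)
  · rw [h, hP] at hneg; exact lt_irrefl _ hneg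

theorem rpow_root_eq (hlam : 0 < lam) (hτ0 : 0 < τ) (hρ : ρ = Upsilon lam τ)
    {P : ℝ} (hP0 : 0 < P) (hP : slopeFun ρ lam τ P = 0)
    (hmin : ∀ p, 0 < p → slopeFun ρ lam τ p = 0 → P ≤ p) : P ^ (τ + 1) = lam * τ := by
  set s := (lam * τ) ^ (1 / (τ + 1)) with hs
  have hp : 0 < s := rpow_pos_of_pos (by positivity) _
  have hsr : s ^ (τ + 1) = lam * τ := rpow_one_div_rpow_add_one hlam hτ0
  have h0 : slopeFun ρ lam τ s = 0 := by rw [hs, slopeFun_critical hlam hτ0, hρ]; simp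
  rcases (hmin s hp h0).lt_or_eq with hlt | heq
  · exfalso
    have hd : ∀ p ∈ Set.Ioc 0 s, HasDerivAt (fun p : ℝ => p - 2 * ρ + lam * p ^ (-τ))
        (1 + lam * (-τ * p ^ (-τ - 1))) p := fun p hp =>
      ((hasDerivAt_id p).sub_const _).fun_add
        ((hasDerivAt_rpow_const (Or.inl hp.1.ne')).const_mul lam)
    have hanti : StrictAntiOn (fun p : ℝ => p - 2 * ρ + lam * p ^ (-τ)) (Set.Ioc 0 s) := by
      refine strictAntiOn_of_deriv_neg (convex_Ioc 0 s)
        (fun p hp => (hd p hp).continuousAt.continuousWithinAt) fun p hp => ?_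
      rw [interior_Ioc] at hp
      rw [(hd p ⟨hp.1, hp.2.le⟩).deriv]
      have h1 : p ^ (τ + 1) < lam * τ := hsr ▸ rpow_lt_rpow hp.1.le hp.2 (by positivity)
      have h2 : p ^ (-τ - 1) * p ^ (τ + 1) = 1 := by rw [← rpow_add hp.1]; simp
      have h3 : 0 < p ^ (-τ - 1) := rpow_pos_of_pos hp.1 _
      have := mul_lt_mul_of_pos_left h1 h3
      nlinarith
    have h1 := hanti ⟨hP0, hlt.le⟩ ⟨hp, le_rfl⟩ hlt
    rw [slopeFun_eq_mul hP0] at hP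
    rw [slopeFun_eq_mul hp] at h0
    have h2 := (mul_eq_zero.mp hP).resolve_left hP0.ne'
    have h3 := (mul_eq_zero.mp h0).resolve_left hp.ne'
    simp only [h2, h3, lt_irrefl] at h1
  · rw [heq, hsr]

theorem exists_linear_le_slopeFun (hlam : 0 < lam) (hτ0 : 0 < τ) (hτ1 : τ < 1) {a P : ℝ}
    (hmin : ∀ p, 0 < p → slopeFun ρ lam τ p = 0 → P ≤ p) (ha : 0 < a) (haP : a < P) :
    ∃ k, 0 < k ∧ ∀ x, 0 < x → x ≤ a → k * x ≤ slopeFun ρ lam τ x := by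
  obtain ⟨k, hk, h⟩ := exists_pos_le_of_continuousOn_Ioc (G := fun x => slopeFun ρ lam τ x / x)
    ha zero_lt_one
    ((continuous_slopeFun hτ1).continuousOn.div continuousOn_id fun x hx => hx.1.ne')
    (fun x hx hxa => div_pos (slopeFun_pos hlam hτ0 hτ1 hmin hx (hxa.trans_lt haP)) hx)
    ((tendsto_slopeFun_div hlam hτ0).eventually_ge_atTop 1)
  exact ⟨k, hk, fun x hx hxa => (le_div_iff₀ hx).mp (h x hx hxa)⟩

theorem exists_linear_le_slopeFun_reflect (hlam : 0 < lam) (hτ0 : 0 < τ) (hτ1 : τ < 1)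
    (hρ : Upsilon lam τ < ρ) {a P : ℝ} (hP : slopeFun ρ lam τ P = 0)
    (hmin : ∀ p, 0 < p → slopeFun ρ lam τ p = 0 → P ≤ p) (ha : 0 < a) (haP : a < P) :
    ∃ k, 0 < k ∧ ∀ x, 0 < x → x ≤ P - a → k * x ≤ slopeFun ρ lam τ (P - x) := by
  have hP0 : 0 < P := ha.trans haP
  have hc : Continuous fun y => slopeFun ρ lam τ (P - y) :=
    (continuous_slopeFun hτ1).comp (by fun_prop)
  set κ := -(2 * P - 2 * ρ + lam * ((1 - τ) * P ^ (-τ))) with hκ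
  have hκ0 : 0 < κ := by
    have h1 := rpow_root_lt hlam hτ0 hτ1 hρ hP0 hP hmin
    have h2 : P ^ (-τ) * P ^ (τ + 1) = P := by rw [← rpow_add hP0]; simp
    have h3 : 0 < P ^ (-τ) := rpow_pos_of_pos hP0 _
    have h4 := mul_lt_mul_of_pos_left h1 h3
    have h5 := (mul_eq_zero.mp (slopeFun_eq_mul (ρ := ρ) (lam := lam) (τ := τ) hP0 ▸ hP)).resolve_left hP0.ne'
    rw [h2] at h4
    rw [hκ]
    linarith
  have hd : HasDerivAt (fun y => slopeFun ρ lam τ (P - y)) κ 0 := by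
    have h1 : HasDerivAt (slopeFun ρ lam τ) (-κ) (P - 0) := by
      rw [hκ, neg_neg, sub_zero]; exact hasDerivAt_slopeFun hP0
    have := h1.comp (0 : ℝ) ((hasDerivAt_id (0 : ℝ)).const_sub P)
    simpa using! this
  have hlim : Tendsto (fun y => slopeFun ρ lam τ (P - y) / y) (𝓝[>] 0) (𝓝 κ) := by
    have := (hasDerivAt_iff_tendsto_slope.mp hd).mono_left
      (nhdsWithin_mono 0 (show Set.Ioi (0 : ℝ) ⊆ {0}ᶜ from fun x hx => ne_of_gt hx))
    refine this.congr fun y => ?_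
    simp [slope_def_field, hP]
  obtain ⟨k, hk, h⟩ := exists_pos_le_of_continuousOn_Ioc
    (G := fun x => slopeFun ρ lam τ (P - x) / x) (sub_pos.mpr haP) (half_pos hκ0)
    (hc.continuousOn.div continuousOn_id fun x hx => hx.1.ne')
    (fun x hx hxa => div_pos (slopeFun_pos hlam hτ0 hτ1 hmin (by linarith) (by linarith)) hx)
    (hlim.eventually (Ici_mem_nhds (half_lt_self hκ0)))
  exact ⟨k, hk, fun x hx hxa => (le_div_iff₀ hx).mp (h x hx hxa)⟩

/-- In the double root case `slopeFun` vanishes exactly quadratically at its root. -/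
theorem exists_quadratic_slopeFun_reflect (hlam : 0 < lam) (hτ0 : 0 < τ) (hτ1 : τ < 1)
    (hρ : ρ = Upsilon lam τ) {a P : ℝ} (hP : slopeFun ρ lam τ P = 0)
    (hmin : ∀ p, 0 < p → slopeFun ρ lam τ p = 0 → P ≤ p) (ha : 0 < a) (haP : a < P) :
    ∃ k C, 0 < k ∧ 0 ≤ C ∧
      (∀ x, 0 < x → x ≤ P - a → k * x ^ 2 ≤ slopeFun ρ lam τ (P - x)) ∧
      ∀ x, 0 < x → x ≤ P - a →
        |slopeFun ρ lam τ (P - x) - (1 + τ) / 2 * x ^ 2| ≤ C * x ^ 3 := by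
  have hP0 : 0 < P := ha.trans haP
  have hroot := rpow_root_eq hlam hτ0 hρ hP0 hP hmin
  have hg := (mul_eq_zero.mp (slopeFun_eq_mul (ρ := ρ) (lam := lam) (τ := τ) hP0 ▸ hP)).resolve_left
    hP0.ne'
  have hlP := lam_mul_rpow_neg hP0 hroot hτ0
  have hlP1 : lam * τ * P ^ (-τ - 1) = 1 := by
    rw [← hroot, ← rpow_add hP0]; simp
  have hτP : τ * (lam * P ^ (-τ)) = P := by rw [hlP]; field_simp
  have hpos : ∀ x ∈ Set.Icc 0 (P - a), 0 < P - x := fun x hx => by linarith [hx.2]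
  have hin : ∀ x : ℝ, HasDerivAt (fun y => P - y) (-1) x := fun x =>
    (hasDerivAt_id x).const_sub P
  have hrp : ∀ e : ℝ, ∀ x ∈ Set.Icc 0 (P - a),
      HasDerivAt (fun y => (P - y) ^ e) (-(e * (P - x) ^ (e - 1))) x := fun e x hx => by
    have := (hasDerivAt_rpow_const (p := e) (Or.inl (hpos x hx).ne')).comp x (hin x)
    simpa using! this
  set C₃ := |lam * τ * (1 - τ) * (τ + 1)| * a ^ (-τ - 2) with hC₃
  have hC₃0 : 0 ≤ C₃ := by positivity
  have b2 := abs_le_mul_pow_succ_of_hasDerivAt (n := 0) (α := P - a) hC₃0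
    (H := fun x => (1 - τ) - lam * τ * (1 - τ) * (P - x) ^ (-τ - 1))
    (fun x hx => ((hrp (-τ - 1) x hx).const_mul (lam * τ * (1 - τ))).const_sub (1 - τ))
    (by simp only [sub_zero]; linear_combination (-(1 - τ)) * hlP1)
    (fun x hx => by
      have e1 : (P - x) ^ (-τ - 1 - 1) ≤ a ^ (-τ - 2) := by
        rw [show -τ - 1 - 1 = -τ - 2 by ring]
        exact rpow_le_rpow_of_nonpos ha (by linarith [hx.2]) (by linarith)
      have e2 : 0 < (P - x) ^ (-τ - 1 - 1) := rpow_pos_of_pos (hpos x hx) _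
      rw [pow_zero, mul_one, hC₃, show -(lam * τ * (1 - τ) * -((-τ - 1) * (P - x) ^ (-τ - 1 - 1)))
        = -(lam * τ * (1 - τ) * (τ + 1) * (P - x) ^ (-τ - 1 - 1)) by ring, abs_neg, abs_mul,
        abs_of_pos e2]
      exact mul_le_mul_of_nonneg_left e1 (abs_nonneg _))
  have b1 := abs_le_mul_pow_succ_of_hasDerivAt (n := 0 + 1) (α := P - a) hC₃0
    (H := fun x => -(2 * (P - x) - 2 * ρ + lam * ((1 - τ) * (P - x) ^ (-τ))) - (1 + τ) * x)
    (fun x hx => by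
      have := (((((hin x).const_mul 2).sub_const (2 * ρ)).fun_add
        (((hrp (-τ) x hx).const_mul (1 - τ)).const_mul lam)).fun_neg).fun_sub
        ((hasDerivAt_id x).const_mul (1 + τ))
      have e : (1 - τ) - lam * τ * (1 - τ) * (P - x) ^ (-τ - 1) =
        -(2 * -1 + lam * ((1 - τ) * -(-τ * (P - x) ^ (-τ - 1)))) - (1 + τ) * 1 := by ring
      rw [e]
      exact this)
    (by simp only [sub_zero, mul_zero]; linear_combination (-1) * hg + hτP)
    b2
  have b0 := abs_le_mul_pow_succ_of_hasDerivAt (n := 0 + 1 + 1) (α := P - a) hC₃0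
    (H := fun x => slopeFun ρ lam τ (P - x) - (1 + τ) / 2 * x ^ 2)
    (fun x hx => by
      have := ((hasDerivAt_slopeFun (ρ := ρ) (lam := lam) (τ := τ) (hpos x hx)).comp x
        (hin x)).fun_sub ((hasDerivAt_pow 2 x).const_mul ((1 + τ) / 2))
      have e : -(2 * (P - x) - 2 * ρ + lam * ((1 - τ) * (P - x) ^ (-τ))) - (1 + τ) * x =
        (2 * (P - x) - 2 * ρ + lam * ((1 - τ) * (P - x) ^ (-τ))) * -1
          - (1 + τ) / 2 * (((2 : ℕ) : ℝ) * x ^ (2 - 1)) := by push_cast; ring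
      rw [e]
      exact this)
    (by simp [hP]) b1
  have hb : ∀ x, 0 < x → x ≤ P - a →
      |slopeFun ρ lam τ (P - x) - (1 + τ) / 2 * x ^ 2| ≤ C₃ * x ^ 3 := fun x hx hxa =>
    b0 x ⟨hx.le, hxa⟩
  have hc : Continuous fun y => slopeFun ρ lam τ (P - y) :=
    (continuous_slopeFun hτ1).comp (by fun_prop)
  have hτ' : (0 : ℝ) < (1 + τ) / 2 := by linarith
  obtain ⟨k, hk, h⟩ := exists_pos_le_of_continuousOn_Ioc
    (G := fun x => slopeFun ρ lam τ (P - x) / x ^ 2) (sub_pos.mpr haP) (half_pos hτ')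
    (hc.continuousOn.div (by fun_prop) fun x hx => pow_ne_zero 2 hx.1.ne')
    (fun x hx hxa => div_pos (slopeFun_pos hlam hτ0 hτ1 hmin (by linarith) (by linarith))
      (by positivity))
    (by
      have h1 : Tendsto (fun x : ℝ => C₃ * x) (𝓝[>] 0) (𝓝 (C₃ * 0)) :=
        (Continuous.tendsto (by fun_prop) 0).mono_left nhdsWithin_le_nhds
      rw [mul_zero] at h1
      filter_upwards [h1.eventually (Iio_mem_nhds (half_pos hτ')),
        Ioo_mem_nhdsGT (sub_pos.mpr haP)] with x h2 h3
      have h4 := neg_le_of_abs_le (hb x h3.1 h3.2.le)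
      rw [le_div_iff₀ (pow_pos h3.1 2)]
      have h5 := mul_lt_mul_of_pos_right (Set.mem_Iio.mp h2) (pow_pos h3.1 2)
      nlinarith)
  exact ⟨k, C₃, hk, hC₃0, fun x hx hxa => (le_div_iff₀ (by positivity)).mp (h x hx hxa), hb⟩

end SlopeFun

theorem hasDerivAt_ite_zero_le {f g d : ℝ → ℝ} (h0 : f 0 = g 0)
    (hf : ∀ t, 0 ≤ t → HasDerivWithinAt f (d t) (Set.Ici 0) t)
    (hg : ∀ t, t ≤ 0 → HasDerivWithinAt g (d t) (Set.Iic 0) t) (t : ℝ) :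
    HasDerivAt (fun t => if 0 ≤ t then f t else g t) (d t) t := by
  have hf' : ∀ t, 0 ≤ t →
      HasDerivWithinAt (fun t => if 0 ≤ t then f t else g t) (d t) (Set.Ici 0) t := fun t ht =>
    (hf t ht).congr (fun s hs => if_pos hs) (if_pos ht)
  have heq : ∀ t, t ≤ 0 → (if 0 ≤ t then f t else g t) = g t := fun t ht => by
    rcases ht.lt_or_eq with h | h
    · exact if_neg (not_le.mpr h)
    · rw [h, if_pos le_rfl, h0]
  have hg' : ∀ t, t ≤ 0 →
      HasDerivWithinAt (fun t => if 0 ≤ t then f t else g t) (d t) (Set.Iic 0) t := fun t ht =>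
    (hg t ht).congr heq (heq t ht)
  rcases lt_trichotomy t 0 with h | h | h
  · exact (hg' t h.le).hasDerivAt (Iic_mem_nhds h)
  · subst h
    have := (hg' 0 le_rfl).union (hf' 0 le_rfl)
    rwa [Set.Iic_union_Ici, hasDerivWithinAt_univ] at this
  · exact (hf' t h.le).hasDerivAt (Ici_mem_nhds h)

/-- A forward and a backward half-orbit with the same starting height glue to a full orbit. -/
theorem IsHalfOrbit.exists_glue {m a P ζ : ℝ} {F y z y' z' : ℝ → ℝ}
    (h : IsHalfOrbit m a F ζ y z) (h' : IsHalfOrbit m (P - a) (fun x => F (P - x)) ζ y' z') :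
    ∃ p w : ℝ → ℝ, (∀ t, HasDerivAt w (m * (p t - a)) t) ∧
      (∀ t, HasDerivAt p (exp (w t) - F (p t)) t) ∧ (∀ t, 0 < a → 0 < p t) ∧
      (∀ t, 0 ≤ t → w t = z t) ∧ ∀ t, 0 ≤ t → w (-t) = z' t := by
  set p : ℝ → ℝ := fun t => if 0 ≤ t then y t else P - y' (-t) with hp
  set w : ℝ → ℝ := fun t => if 0 ≤ t then z t else z' (-t) with hw
  have hp1 : ∀ t, 0 ≤ t → p t = y t := fun t ht => if_pos ht
  have hw1 : ∀ t, 0 ≤ t → w t = z t := fun t ht => if_pos ht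
  have hp0 : y 0 = P - y' (-0) := by rw [neg_zero, h.y_zero, h'.y_zero]; ring
  have hw0 : z 0 = z' (-0) := by rw [neg_zero, h.z_zero, h'.z_zero]
  have hp2 : ∀ t, t ≤ 0 → p t = P - y' (-t) := fun t ht => by
    rcases ht.lt_or_eq with h3 | h3
    · exact if_neg (not_le.mpr h3)
    · rw [h3, hp1 0 le_rfl, hp0]
  have hw2 : ∀ t, t ≤ 0 → w t = z' (-t) := fun t ht => by
    rcases ht.lt_or_eq with h3 | h3
    · exact if_neg (not_le.mpr h3)
    · rw [h3, hw1 0 le_rfl, hw0]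
  have hmap : Set.MapsTo (fun t : ℝ => -t) (Set.Iic 0) (Set.Ici 0) := fun t ht =>
    Set.mem_Ici.mpr (neg_nonneg.mpr (Set.mem_Iic.mp ht))
  refine ⟨p, w, hasDerivAt_ite_zero_le hw0 (fun t ht => ?_) (fun t ht => ?_),
    hasDerivAt_ite_zero_le hp0 (fun t ht => ?_) (fun t ht => ?_), fun t ha => ?_, hw1,
    fun t ht => ?_⟩
  · rw [hp1 t ht, show m * (y t - a) = -(m * (a - y t)) by ring]
    exact h.hasDerivWithinAt_z ht
  · have := (h'.hasDerivWithinAt_z (neg_nonneg.mpr ht)).comp t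
      (hasDerivAt_neg t).hasDerivWithinAt hmap
    rw [hp2 t ht, show m * (P - y' (-t) - a) = -(m * (P - a - y' (-t))) * -1 by ring]
    exact this
  · rw [hp1 t ht, hw1 t ht]
    exact h.hasDerivWithinAt_y ht
  · have := ((h'.hasDerivWithinAt_y (neg_nonneg.mpr ht)).comp t
      (hasDerivAt_neg t).hasDerivWithinAt hmap).const_sub P
    rw [hp2 t ht, hw2 t ht, show exp (z' (-t)) - F (P - y' (-t))
      = -((exp (z' (-t)) - F (P - y' (-t))) * -1) by ring]
    exact this
  · rcases le_total 0 t with h3 | h3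
    · rw [hp1 t h3]; exact h.pos h3
    · rw [hp2 t h3]
      linarith [h'.le (neg_nonneg.mpr h3)]
  · rw [hw2 _ (neg_nonpos.mpr ht), neg_neg]

theorem exists_eq_of_monotone_add_linear {G : ℝ → ℝ} {ζs σ : ℝ} (hσ : 0 < σ)
    (hmono : MonotoneOn G (Set.Iio ζs)) (hcont : ContinuousOn G (Set.Iio ζs))
    (hlim : Tendsto G (𝓝[<] ζs) atTop) (A : ℝ) : ∃ ζ < ζs, σ * ζ + G ζ = A := by
  have hlim' : Tendsto (fun ζ => σ * ζ + G ζ) (𝓝[<] ζs) atTop :=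
    (((continuous_const_mul σ).tendsto ζs).mono_left nhdsWithin_le_nhds).add_atTop hlim
  obtain ⟨ζ₁, h1, h1s⟩ := ((hlim'.eventually_ge_atTop A).and self_mem_nhdsWithin).exists
  have h1s' : ζ₁ < ζs := h1s
  set ζ₀ := min ζ₁ ((A - G ζ₁) / σ)
  have h01 : ζ₀ ≤ ζ₁ := min_le_left _ _
  have h0 : σ * ζ₀ + G ζ₀ ≤ A := by
    have e1 := hmono (Set.mem_Iio.mpr (h01.trans_lt h1s')) h1s h01
    have e2 : ζ₀ ≤ (A - G ζ₁) / σ := min_le_right _ _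
    rw [le_div_iff₀ hσ] at e2
    linarith
  have hsub : Set.Icc ζ₀ ζ₁ ⊆ Set.Iio ζs := fun x hx => hx.2.trans_lt h1s'
  obtain ⟨ζ, hζ, h⟩ := intermediate_value_Icc h01
    ((continuous_const_mul σ).continuousOn.add (hcont.mono hsub)) ⟨h0, h1⟩
  exact ⟨ζ, hsub hζ, h⟩

/-- A global orbit with prescribed asymptotics at both ends. -/
theorem exists_connecting_orbit {m a P : ℝ} {F R : ℝ → ℝ} (hm : 0 < m) (ha : 0 < a)
    (haP : a < P) (hF : IsAdmissible F a) (hF' : IsAdmissible (fun x => F (P - x)) (P - a))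
    (hFa : 0 < F a)
    (hlim : ∀ ζ y z, exp ζ < F a → IsHalfOrbit m a F ζ y z →
      ∃ L, Tendsto (fun t => (z t - ζ) / m + a * t) atTop (𝓝 L))
    (hlim' : ∀ ζ y z, exp ζ < F a → IsHalfOrbit m (P - a) (fun x => F (P - x)) ζ y z →
      ∃ L, Tendsto (fun t => (z t - ζ) / m + (P - a) * t - R t) atTop (𝓝 L)) (A B : ℝ) :
    ∃ (ℓ p : ℝ → ℝ) (s : ℝ), (∀ t, HasDerivAt ℓ (p t) t) ∧
      (∀ t, HasDerivAt p (exp (m * (ℓ t - a * t)) - F (p t)) t) ∧ (∀ t, 0 < p t) ∧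
      Tendsto ℓ atTop (𝓝 A) ∧ Tendsto (fun t => ℓ t - P * t - R (s - t)) atBot (𝓝 B) := by
  have hb : 0 < P - a := sub_pos.mpr haP
  have hζs : exp (log (F a)) = F a := exp_log hFa
  have hFP : F (P - (P - a)) = F a := by rw [sub_sub_cancel]
  have hlt : ∀ ζ, ζ < log (F a) → exp ζ < F a := fun ζ h => hζs ▸ exp_lt_exp.mpr h
  obtain ⟨y, z, I, ho, hI, hIm, hIc, hIt⟩ := exists_halfOrbit_family (R := fun _ => 0) hF hm hζs
    fun ζ y z h ho => by simpa using hlim ζ y z (hlt ζ h) ho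
  obtain ⟨y', z', J, ho', hJ, hJm, hJc, hJt⟩ := exists_halfOrbit_family (R := R) hF' hm
    (hζs.trans hFP.symm) fun ζ y z h ho => hlim' ζ y z (hlt ζ h) ho
  obtain ⟨ζ, hζ, hκ⟩ := exists_eq_of_monotone_add_linear (σ := P / m) (ζs := log (F a))
    (G := fun ζ => a * J ζ + (P - a) * I ζ) (div_pos (ha.trans haP) hm)
    (fun x hx x' hx' h => add_le_add (mul_le_mul_of_nonneg_left (hJm hx hx' h) ha.le)
      (mul_le_mul_of_nonneg_left (hIm hx hx' h) hb.le))
    ((hJc.const_mul a).add (hIc.const_mul (P - a)))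
    ((hJt.const_mul_atTop ha).atTop_add_atTop (hIt.const_mul_atTop hb)) (a * B + (P - a) * A)
  obtain ⟨p, w, hw, hp, hpos, hwz, hwz'⟩ := (ho ζ hζ).exists_glue (ho' ζ hζ)
  set s := (A - I ζ - ζ / m) / a with hs
  have hsA : a * s = A - I ζ - ζ / m := by rw [hs]; field_simp
  have hsB : J ζ + ζ / m - (P - a) * s = B := by
    refine mul_left_cancel₀ ha.ne' ?_
    have e : P / m * ζ = P * (ζ / m) := by ring
    rw [e] at hκ
    linear_combination hκ - (P - a) * hsA
  have hsh : ∀ t, HasDerivAt (fun t => t - s) 1 t := fun t => (hasDerivAt_id t).sub_const s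
  refine ⟨fun t => w (t - s) / m + a * t, fun t => p (t - s), s, fun t => ?_, fun t => ?_,
    fun t => hpos _ ha, ?_, ?_⟩
  · have := (((hw (t - s)).comp t (hsh t)).div_const m).fun_add ((hasDerivAt_id t).const_mul a)
    beta_reduce
    rw [show p (t - s) = m * (p (t - s) - a) * 1 / m + a * 1 by field_simp; ring]
    exact this
  · have := (hp (t - s)).comp t (hsh t)
    beta_reduce
    rw [show m * (w (t - s) / m + a * t - a * t) = w (t - s) by field_simp; ring, ← mul_one (_ - _)]
    exact this
  · have h1 := (hI ζ hζ).comp (tendsto_atTop_add_const_right atTop (-s) tendsto_id)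
    have h2 := h1.add_const (ζ / m + a * s)
    rw [show I ζ + (ζ / m + a * s) = A by rw [hsA]; ring] at h2
    refine h2.congr' ?_
    filter_upwards [eventually_ge_atTop s] with t ht
    simp only [Function.comp, id, ← sub_eq_add_neg]
    rw [hwz _ (sub_nonneg.mpr ht), sub_div]
    ring
  · have h1 := (hJ ζ hζ).comp (tendsto_atTop_add_const_left atBot s tendsto_neg_atBot_atTop)
    have h2 := h1.add_const (ζ / m - (P - a) * s)
    rw [show J ζ + (ζ / m - (P - a) * s) = B by rw [← hsB]; ring] at h2
    refine h2.congr' ?_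
    filter_upwards [eventually_le_atBot s] with t ht
    have := hwz' (s - t) (sub_nonneg.mpr ht)
    rw [neg_sub] at this
    simp only [Function.comp, ← sub_eq_add_neg]
    rw [this, sub_div]
    ring

theorem Phi2_exp_pos (ρ lam τ w : ℝ) {t : ℝ} (ht : t < 0) : 0 < Phi2 ρ lam τ w (exp t) := by
  unfold Phi2
  rw [log_exp]
  have := abs_pos.mpr ht.ne
  split_ifs <;> positivity

theorem tendsto_log_sub_log_atBot (s : ℝ) :
    Tendsto (fun t : ℝ => log (s - t) - log (-t)) atBot (𝓝 0) := by
  have h1 : Tendsto (fun t : ℝ => 1 - s * t⁻¹) atBot (𝓝 1) := by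
    simpa using (tendsto_inv_atBot_zero (𝕜 := ℝ)).const_mul s |>.const_sub 1
  have h2 := h1.log one_ne_zero
  rw [log_one] at h2
  refine h2.congr' ?_
  filter_upwards [eventually_lt_atBot 0, eventually_lt_atBot s] with t h0 hs
  rw [← log_div (sub_pos.mpr hs).ne' (neg_pos.mpr h0).ne']
  congr 1
  have := h0.ne
  field_simp
  ring

/-- The slope equation has a global solution whose logarithmic profile matches `Φ_{ϖ₂}` at `-∞`
and is asymptotically constant at `+∞`. -/
theorem exists_log_profile {ρ lam τ m a w : ℝ} (hlam : 0 < lam) (hτ0 : 0 < τ) (hτ1 : τ < 1)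
    (hρ : Upsilon lam τ ≤ ρ) (hw : IsMaxNegRoot ρ lam τ w) (hm : 0 < m) (ha : 0 < a)
    (haw : a < -w) (A B : ℝ) :
    ∃ ℓ p : ℝ → ℝ, (∀ t, HasDerivAt ℓ (p t) t) ∧
      (∀ t, HasDerivAt p (exp (m * (ℓ t - a * t)) - slopeFun ρ lam τ (p t)) t) ∧
      (∀ t, 0 < p t) ∧ Tendsto ℓ atTop (𝓝 A) ∧
      Tendsto (fun t => ℓ t - log (Phi2 ρ lam τ w (exp t))) atBot (𝓝 B) := by
  obtain ⟨hw0, hroot, hmax⟩ := hw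
  have hP : slopeFun ρ lam τ (-w) = 0 := by
    rw [← fRho_neg (neg_pos.mpr hw0), neg_neg, hroot]
  have hmin : ∀ p, 0 < p → slopeFun ρ lam τ p = 0 → -w ≤ p := fun p hp h =>
    neg_le.mp (hmax (-p) (neg_neg_of_pos hp) (by rw [fRho_neg hp, h]))
  have hF := isAdmissible_slopeFun (ρ := ρ) (lam := lam) hτ1 ha
  have hF' := isAdmissible_slopeFun_reflect hτ1 ha haw hP
  have hFa := slopeFun_pos hlam hτ0 hτ1 hmin ha haw
  have hFP : slopeFun ρ lam τ (-w - (-w - a)) = slopeFun ρ lam τ a := by rw [sub_sub_cancel]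
  obtain ⟨k, hk, hkF⟩ := exists_linear_le_slopeFun hlam hτ0 hτ1 hmin ha haw
  have hlim := fun ζ y z h (ho : IsHalfOrbit m a (slopeFun ρ lam τ) ζ y z) =>
    ho.exists_tendsto_mass_of_linear hF hm h hk hkF
  rcases hρ.lt_or_eq with hρ' | hρ'
  · obtain ⟨k', hk', hkF'⟩ := exists_linear_le_slopeFun_reflect hlam hτ0 hτ1 hρ' hP hmin ha haw
    obtain ⟨ℓ, p, s, hℓ, hp, hpos, htop, hbot⟩ := exists_connecting_orbit (R := fun _ => 0) hm ha
      haw hF hF' hFa hlim (fun ζ y z h ho => by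
        simpa using ho.exists_tendsto_mass_of_linear hF' hm (h.trans_eq hFP.symm) hk' hkF') A B
    refine ⟨ℓ, p, hℓ, hp, hpos, htop, hbot.congr fun t => ?_⟩
    rw [Phi2, if_neg hρ'.ne', ← exp_mul, log_exp]
    ring
  · obtain ⟨k', C, hk', hC, hkF', hkC⟩ :=
      exists_quadratic_slopeFun_reflect hlam hτ0 hτ1 hρ'.symm hP hmin ha haw
    obtain ⟨ℓ, p, s, hℓ, hp, hpos, htop, hbot⟩ := exists_connecting_orbit
      (R := fun t => 1 / ((1 + τ) / 2) * log t) hm ha haw hF hF' hFa hlim (fun ζ y z h ho =>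
        ho.exists_tendsto_mass_of_quadratic hF' hm (h.trans_eq hFP.symm) hk' (by positivity) hC
          hkF' hkC) A B
    refine ⟨ℓ, p, hℓ, hp, hpos, htop, ?_⟩
    have h1 := hbot.add ((tendsto_log_sub_log_atBot s).const_mul (2 / (1 + τ)))
    rw [mul_zero, add_zero] at h1
    refine h1.congr' ?_
    filter_upwards [eventually_lt_atBot 0] with t ht
    rw [Phi2, if_pos hρ'.symm, log_exp, abs_of_neg ht, ← exp_mul, log_mul (exp_pos _).ne'
      (rpow_pos_of_pos (neg_pos.mpr ht) _).ne', log_exp, log_rpow (neg_pos.mpr ht), one_div_div]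
    ring

theorem tendsto_log_norm_nhdsNE_zero (E : Type*) [NormedAddCommGroup E] :
    Tendsto (fun x : E => log ‖x‖) (𝓝[≠] 0) atBot :=
  tendsto_log_nhdsGT_zero.comp tendsto_norm_nhdsNE_zero

theorem tendsto_div_of_tendsto_div_const {ι : Type*} {l : Filter ι} {f g h : ι → ℝ}
    (hh : ∀ᶠ x in l, h x ≠ 0) (hf : Tendsto (fun x => f x / h x) l (𝓝 1))
    (hg : Tendsto (fun x => g x / h x) l (𝓝 1)) : Tendsto (fun x => f x / g x) l (𝓝 1) := by
  have := hf.div hg one_ne_zero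
  rw [div_one] at this
  refine this.congr' ?_
  filter_upwards [hh] with x hx
  exact div_div_div_cancel_right₀ hx _ _

/-- In Case [N₂] with `β ∈ (ϖ₂, 0)`, for every `b > 0` and `c > 0` there is
a unique positive solution `u_{b,∞,c}` of (E) in `ℝ^N \ {0}` with `u ~ b Φ_{ϖ₂}` near zero
and `u → c` at infinity; moreover it is radially symmetric with positive radial derivative
on `(0,∞)`. -/
theorem stmt4_exists_unique_u_b_infty_c
    (N : ℕ) (hN : 2 ≤ N) (ρ lam τ θ q : ℝ)
    (hτ0 : 0 ≤ τ) (hτ1 : τ < 1) (hq : 1 < q)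
    (hcase : CaseN2 ρ lam τ)
    (w2 : ℝ) (hw2 : IsMaxNegRoot ρ lam τ w2)
    (hβ1 : w2 < (θ + 2) / (q - 1)) (hβ2 : (θ + 2) / (q - 1) < 0)
    (b c : ℝ) (hb : 0 < b) (hc : 0 < c) :
    ∃ u : EuclideanSpace ℝ (Fin N) → ℝ,
      IsSolutionE N ρ lam τ θ q Set.univ u ∧
      Filter.Tendsto (fun x : EuclideanSpace ℝ (Fin N) => u x / (b * Phi2 ρ lam τ w2 ‖x‖))
        (𝓝[≠] (0 : EuclideanSpace ℝ (Fin N))) (𝓝 1) ∧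
      Filter.Tendsto u (cocompact (EuclideanSpace ℝ (Fin N))) (𝓝 c) ∧
      (∃ v : ℝ → ℝ, ContDiffOn ℝ 1 v (Set.Ioi 0) ∧
        (∀ x : EuclideanSpace ℝ (Fin N), x ≠ 0 → u x = v ‖x‖) ∧
        ∀ r : ℝ, 0 < r → 0 < deriv v r) ∧
      ∀ u' : EuclideanSpace ℝ (Fin N) → ℝ,
        IsSolutionE N ρ lam τ θ q Set.univ u' →
        Filter.Tendsto (fun x : EuclideanSpace ℝ (Fin N) => u' x / (b * Phi2 ρ lam τ w2 ‖x‖))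
          (𝓝[≠] (0 : EuclideanSpace ℝ (Fin N))) (𝓝 1) →
        Filter.Tendsto u' (cocompact (EuclideanSpace ℝ (Fin N))) (𝓝 c) →
        ∀ x : EuclideanSpace ℝ (Fin N), x ≠ 0 → u' x = u x := by
  obtain ⟨hlam, hτ, -, hρ⟩ := hcase
  have hm : 0 < q - 1 := sub_pos.mpr hq
  obtain ⟨ℓ, p, hℓ, hp, hpos, htop, hbot⟩ := exists_log_profile hlam hτ hτ1 hρ hw2 hm
    (neg_pos.mpr hβ2) (neg_lt_neg hβ1) (log c) (log b)
  have hlog0 := tendsto_log_norm_nhdsNE_zero (EuclideanSpace ℝ (Fin N))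
  have hnorm : ∀ᶠ x : EuclideanSpace ℝ (Fin N) in 𝓝[≠] 0, exp (log ‖x‖) = ‖x‖ := by
    filter_upwards [self_mem_nhdsWithin] with x hx
    exact exp_log (norm_pos_iff.mpr hx)
  have hΦ : ∀ᶠ x : EuclideanSpace ℝ (Fin N) in 𝓝[≠] 0, 0 < Phi2 ρ lam τ w2 ‖x‖ := by
    filter_upwards [hlog0.eventually_lt_atBot 0, hnorm] with x hx hn
    rw [← hn]
    exact Phi2_exp_pos ρ lam τ w2 hx
  have hsol : IsSolutionE N ρ lam τ θ q Set.univ (fun x => exp (ℓ (log ‖x‖))) :=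
    isSolutionE_of_log_radial hN hτ1 (by field_simp) hℓ hp hpos
  have hzero : Tendsto (fun x : EuclideanSpace ℝ (Fin N) =>
      exp (ℓ (log ‖x‖)) / (b * Phi2 ρ lam τ w2 ‖x‖)) (𝓝[≠] 0) (𝓝 1) := by
    have h1 := ((hbot.comp hlog0).sub_const (log b)).rexp
    rw [sub_self, exp_zero] at h1
    refine h1.congr' ?_
    filter_upwards [hΦ, hnorm] with x hx hn
    simp only [Function.comp]
    rw [hn, sub_sub, exp_sub, exp_add, exp_log hx, exp_log hb, mul_comm b]
  have hinf : Tendsto (fun x : EuclideanSpace ℝ (Fin N) => exp (ℓ (log ‖x‖)))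
      (cocompact _) (𝓝 c) := by
    have h1 := (htop.comp (tendsto_log_atTop.comp
      (tendsto_norm_cocompact_atTop (E := EuclideanSpace ℝ (Fin N))))).rexp
    rwa [exp_log hc] at h1
  have hpc : Continuous p := continuous_iff_continuousAt.mpr fun t => (hp t).continuousAt
  refine ⟨_, hsol, hzero, hinf, ⟨fun r => exp (ℓ (log r)), ?_, fun x _ => rfl, fun r hr => ?_⟩,
    fun u' hu' hz hi x hx => ?_⟩
  · exact ((contDiff_one_of_hasDerivAt hℓ hpc).comp_contDiffOn
      (contDiffOn_id.log fun r hr => (Set.mem_Ioi.mp hr).ne')).exp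
  · have hd : HasDerivAt (fun r => exp (ℓ (log r))) (exp (ℓ (log r)) * (p (log r) * r⁻¹)) r :=
      ((hℓ (log r)).comp r (hasDerivAt_log hr.ne')).exp
    rw [hd.deriv]
    have := hpos (log r)
    positivity
  · have hne : ∀ᶠ x : EuclideanSpace ℝ (Fin N) in 𝓝[≠] 0, b * Phi2 ρ lam τ w2 ‖x‖ ≠ 0 :=
      hΦ.mono fun x h => (mul_pos hb h).ne'
    have h1 := hi.div hinf hc.ne'
    have h2 := hinf.div hi hc.ne'
    rw [div_self hc.ne'] at h1 h2
    exact le_antisymm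
      (solution_le_of_tendsto_div hN hτ1 hq hu' hsol
        (tendsto_div_of_tendsto_div_const hne hz hzero) h1 hx)
      (solution_le_of_tendsto_div hN hτ1 hq hsol hu'
        (tendsto_div_of_tendsto_div_const hne hzero hz) h2 hx)

end
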